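/- Let S² be the unit sphere in ℝ³ centred at the origin and let V ⊆ S² be a finite set with |V| ≥ 8 such that N(V) = (17/4)|V| − 6. Then V = −V (V is symmetric about the origin), every 2-dimensional exposed face of conv V is either a rectangle or an acute triangle, and every point of V belongs to exactly 3 rectangular 2-dimensional exposed faces of conv V. -/

import Mathlib

open scoped RealInnerProductSpace Classical

noncomputable section

abbrev Euc (d : ℕ) : Type := EuclideanSpace ℝ (Fin d)

/-- `{p, q}` is a double-normal pair of the finite point set `V`. -/
def IsDNPair {d : ℕ} (V : Finset (Euc d)) (p q : Euc d) : Prop :=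
  p ∈ V ∧ q ∈ V ∧ p ≠ q ∧
    ∀ v ∈ V, 0 ≤ ⟪v - p, q - p⟫ ∧ 0 ≤ ⟪v - q, p - q⟫

/-- `N(V)`: the number of (unordered) double-normal pairs of `V`. -/
def numDN {d : ℕ} (V : Finset (Euc d)) : ℕ :=
  ((V ×ˢ V).filter fun pq => IsDNPair V pq.1 pq.2).card / 2

/-- `{p, q}` is a strict double-normal pair of `V`. -/
def IsStrictDNPair {d : ℕ} (V : Finset (Euc d)) (p q : Euc d) : Prop :=
  IsDNPair V p q ∧
    ∀ v ∈ V, v ≠ p → v ≠ q → 0 < ⟪v - p, q - p⟫ ∧ 0 < ⟪v - q, p - q⟫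

/-- `N'(V)`: the number of (unordered) strict double-normal pairs of `V`. -/
def numStrictDN {d : ℕ} (V : Finset (Euc d)) : ℕ :=
  ((V ×ˢ V).filter fun pq => IsStrictDNPair V pq.1 pq.2).card / 2

/-- `F` is an exposed face of `P` (cut out by a nonzero linear functional). -/
def IsExpFace (P F : Set (Euc 3)) : Prop :=
  ∃ u : Euc 3, u ≠ 0 ∧ F = {p ∈ P | ∀ x ∈ P, ⟪x, u⟫ ≤ ⟪p, u⟫}

/-- `F` is a 2-dimensional exposed face of `P`. -/
def IsTwoDimExpFace (P F : Set (Euc 3)) : Prop :=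
  IsExpFace P F ∧ Module.finrank ℝ (vectorSpan ℝ F) = 2

/-- `F` is a rectangle: the convex hull of four distinct points `w, x, y, z` with
`w + y = x + z` and `⟪x - w, z - w⟫ = 0`. -/
def IsRectangle (F : Set (Euc 3)) : Prop :=
  ∃ w x y z : Euc 3, w ≠ x ∧ w ≠ y ∧ w ≠ z ∧ x ≠ y ∧ x ≠ z ∧ y ≠ z ∧
    w + y = x + z ∧ ⟪x - w, z - w⟫ = 0 ∧ F = convexHull ℝ {w, x, y, z}

/-- `F` is a triangle: the convex hull of three affinely independent points. -/
def IsTriangle (F : Set (Euc 3)) : Prop :=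
  ∃ a b c : Euc 3, AffineIndependent ℝ ![a, b, c] ∧ F = convexHull ℝ {a, b, c}

/-- `F` is an acute triangle: the convex hull of three affinely independent points,
all of whose angles are acute. -/
def IsAcuteTriangle (F : Set (Euc 3)) : Prop :=
  ∃ a b c : Euc 3, AffineIndependent ℝ ![a, b, c] ∧
    0 < ⟪b - a, c - a⟫ ∧ 0 < ⟪a - b, c - b⟫ ∧ 0 < ⟪a - c, b - c⟫ ∧
    F = convexHull ℝ {a, b, c}

theorem perp3 {x y z g : Euc 3} (h : LinearIndependent ℝ ![x, y, z])
    (hx : ⟪g, x⟫ = 0) (hy : ⟪g, y⟫ = 0) (hz : ⟪g, z⟫ = 0) : g = 0 := by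
  have hs : Submodule.span ℝ (Set.range ![x, y, z]) = ⊤ :=
    h.span_eq_top_of_card_eq_finrank (by simp)
  have hg : g ∈ Submodule.span ℝ (Set.range ![x, y, z]) := by rw [hs]; trivial
  have key : ∀ w ∈ Submodule.span ℝ (Set.range ![x, y, z]), ⟪g, w⟫ = 0 := by
    intro w hw
    induction hw using Submodule.span_induction with
    | mem w hw =>
      obtain ⟨i, rfl⟩ := hw
      fin_cases i <;> simp [hx, hy, hz]
    | zero => simp
    | add a b _ _ ha hb => rw [inner_add_right, ha, hb, add_zero]
    | smul a w _ hw => rw [inner_smul_right, hw, mul_zero]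
  exact inner_self_eq_zero.mp (key g hg)

theorem inner_lt_one' {x y : Euc 3} (hx : ⟪x, x⟫ = 1) (hy : ⟪y, y⟫ = 1) (h : x ≠ y) :
    ⟪x, y⟫ < 1 := by
  have h1 : 0 < ⟪x - y, x - y⟫ := real_inner_self_pos.mpr (sub_ne_zero.mpr h)
  simp only [inner_sub_left, inner_sub_right, hx, hy, real_inner_comm x y] at h1
  linarith

theorem li3 {u x y z : Euc 3} (hx : ⟪x, x⟫ = 1) (hy : ⟪y, y⟫ = 1) (hz : ⟪z, z⟫ = 1)
    (ux : ⟪u, x⟫ = 1) (uy : ⟪u, y⟫ = 1) (uz : ⟪u, z⟫ = 1)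
    (hxy : x ≠ y) (hxz : x ≠ z) (hyz : y ≠ z) : LinearIndependent ℝ ![x, y, z] := by
  rw [Fintype.linearIndependent_iff]
  intro g hg
  simp only [Fin.sum_univ_three, Matrix.cons_val_zero, Matrix.cons_val_one,
    Matrix.cons_val] at hg
  have h1 : g 0 + g 1 + g 2 = 0 := by
    have := congrArg (fun t => ⟪u, t⟫) hg
    simpa [inner_add_right, inner_smul_right, ux, uy, uz] using this
  have e1 : ⟪x, y⟫ < 1 := inner_lt_one' hx hy hxy
  have h2 : ⟪g 0 • x + g 1 • y + g 2 • z, g 0 • x + g 1 • y - g 2 • z⟫ = 0 := by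
    rw [hg]; simp
  simp only [inner_add_left, inner_add_right, inner_sub_right, inner_smul_left,
    inner_smul_right, hx, hy, hz, real_inner_comm x y, real_inner_comm x z,
    real_inner_comm y z, RCLike.conj_to_real] at h2
  have h3 : g 2 = -(g 0 + g 1) := by linarith
  have h4 : g 0 * g 1 * (1 - ⟪x, y⟫) = 0 := by
    rw [h3] at h2; linarith
  have h5 : g 0 * g 1 = 0 := by
    rcases mul_eq_zero.mp h4 with h | h
    · exact h
    · linarith
  have h6 : g 0 = 0 ∧ g 1 = 0 := by
    rcases mul_eq_zero.mp h5 with h | h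
    · refine ⟨h, ?_⟩
      by_contra h7
      have : g 1 • (y - z) = 0 := by
        rw [h3, h] at hg; rw [smul_sub]; simpa [sub_eq_add_neg] using hg
      rcases smul_eq_zero.mp this with h8 | h8
      · exact h7 h8
      · exact hyz (sub_eq_zero.mp h8)
    · refine ⟨?_, h⟩
      by_contra h7
      have : g 0 • (x - z) = 0 := by
        rw [h3, h] at hg; rw [smul_sub]; simpa [sub_eq_add_neg] using hg
      rcases smul_eq_zero.mp this with h8 | h8
      · exact h7 h8
      · exact hxz (sub_eq_zero.mp h8)
  intro i
  fin_cases i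
  · exact h6.1
  · exact h6.2
  · simp [h3, h6.1, h6.2]

theorem exists_perp (v w : Euc 3) : ∃ e : Euc 3, e ≠ 0 ∧ ⟪e, v⟫ = 0 ∧ ⟪e, w⟫ = 0 := by
  let L : Euc 3 →ₗ[ℝ] ℝ × ℝ := (innerₛₗ ℝ v).prod (innerₛₗ ℝ w)
  have hL : LinearMap.ker L ≠ ⊥ := LinearMap.ker_ne_bot_of_finrank_lt (by simp)
  obtain ⟨e, he, he0⟩ := Submodule.exists_mem_ne_zero_of_ne_bot hL
  refine ⟨e, he0, ?_⟩
  have : L e = 0 := he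
  have h1 : ⟪v, e⟫ = 0 := congrArg Prod.fst this
  have h2 : ⟪w, e⟫ = 0 := congrArg Prod.snd this
  exact ⟨by rw [real_inner_comm]; exact h1, by rw [real_inner_comm]; exact h2⟩

/-- mutually orthogonal case -/
theorem perp_orth {x y z g : Euc 3} (hx : x ≠ 0) (hy : y ≠ 0) (hz : z ≠ 0)
    (hxy : ⟪x, y⟫ = 0) (hxz : ⟪x, z⟫ = 0) (hyz : ⟪y, z⟫ = 0)
    (gx : ⟪g, x⟫ = 0) (gy : ⟪g, y⟫ = 0) (gz : ⟪g, z⟫ = 0) : g = 0 := by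
  refine perp3 (x := x) (y := y) (z := z) ?_ gx gy gz
  apply linearIndependent_of_ne_zero_of_inner_eq_zero (𝕜 := ℝ)
  · intro i; fin_cases i <;> simpa
  · intro i j hij
    fin_cases i <;> fin_cases j <;> simp_all [real_inner_comm]

theorem two_zero {a b p q : ℝ} (hp : 0 < p) (hq : 0 < q) (h : a * p + b * q = 0)
    (hs : (0 ≤ a ∧ 0 ≤ b) ∨ (a ≤ 0 ∧ b ≤ 0)) : a = 0 ∧ b = 0 := by
  rcases hs with ⟨h1, h2⟩ | ⟨h1, h2⟩
  · have e1 := mul_nonneg h1 hp.le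
    have e2 := mul_nonneg h2 hq.le
    have e3 : a * p = 0 := by linarith
    have e4 : b * q = 0 := by linarith
    exact ⟨(mul_eq_zero.mp e3).resolve_right hp.ne', (mul_eq_zero.mp e4).resolve_right hq.ne'⟩
  · have e1 := mul_nonneg (neg_nonneg.mpr h1) hp.le
    have e2 := mul_nonneg (neg_nonneg.mpr h2) hq.le
    have e3 : a * p = 0 := by linarith
    have e4 : b * q = 0 := by linarith
    exact ⟨(mul_eq_zero.mp e3).resolve_right hp.ne', (mul_eq_zero.mp e4).resolve_right hq.ne'⟩

/-- three directions lemma -/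
theorem three_dirs {v f d1 d2 d3 c1 c2 c3 : Euc 3} (hf : f ≠ 0)
    (v1 : ⟪d1, v⟫ < 0) (v2 : ⟪d2, v⟫ < 0) (v3 : ⟪d3, v⟫ < 0)
    (f1 : ⟪d1, f⟫ = 0) (f2 : ⟪d2, f⟫ = 0) (f3 : ⟪d3, f⟫ = 0)
    (h11 : ⟪c1, d1⟫ = 0) (h22 : ⟪c2, d2⟫ = 0) (h33 : ⟪c3, d3⟫ = 0)
    (h12 : 0 < ⟪c1, d2⟫) (h13 : 0 < ⟪c1, d3⟫) (h21 : 0 < ⟪c2, d1⟫) (h23 : 0 < ⟪c2, d3⟫)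
    (h31 : 0 < ⟪c3, d1⟫) (h32 : 0 < ⟪c3, d2⟫) : False := by
  have hli : ¬ LinearIndependent ℝ ![d1, d2, d3] := fun h =>
    hf (perp3 h (by rw [real_inner_comm]; exact f1) (by rw [real_inner_comm]; exact f2)
      (by rw [real_inner_comm]; exact f3))
  rw [Fintype.not_linearIndependent_iff] at hli
  obtain ⟨g, hg, i, hi⟩ := hli
  simp only [Fin.sum_univ_three, Matrix.cons_val_zero, Matrix.cons_val_one,
    Matrix.cons_val] at hg
  have key : ∀ t : Euc 3, g 0 * ⟪t, d1⟫ + g 1 * ⟪t, d2⟫ + g 2 * ⟪t, d3⟫ = 0 := by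
    intro t
    have := congrArg (fun s => ⟪t, s⟫) hg
    simpa [inner_add_right, inner_smul_right] using this
  have kv := key v
  have k1 := key c1
  have k2 := key c2
  have k3 := key c3
  rw [h11] at k1; rw [h22] at k2; rw [h33] at k3
  rw [real_inner_comm] at v1 v2 v3
  have fin : ¬ (g 0 = 0 ∧ g 1 = 0 ∧ g 2 = 0) := by
    rintro ⟨a, b, c⟩
    fin_cases i
    · exact hi a
    · exact hi b
    · exact hi c
  have r1 : ∀ {a p : ℝ}, p < 0 → a * p = 0 → a = 0 := fun hp h =>
    (mul_eq_zero.mp h).resolve_right hp.ne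
  have case3 : ((0 ≤ g 0 ∧ 0 ≤ g 1) ∨ (g 0 ≤ 0 ∧ g 1 ≤ 0)) → False := by
    intro hs
    obtain ⟨a, b⟩ := two_zero h31 h32 (by linarith) hs
    rw [a, b] at kv
    exact fin ⟨a, b, r1 v3 (by linarith)⟩
  have case2 : ((0 ≤ g 0 ∧ 0 ≤ g 2) ∨ (g 0 ≤ 0 ∧ g 2 ≤ 0)) → False := by
    intro hs
    obtain ⟨a, b⟩ := two_zero h21 h23 (by linarith) hs
    rw [a, b] at kv
    exact fin ⟨a, r1 v2 (by linarith), b⟩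
  have case1 : ((0 ≤ g 1 ∧ 0 ≤ g 2) ∨ (g 1 ≤ 0 ∧ g 2 ≤ 0)) → False := by
    intro hs
    obtain ⟨a, b⟩ := two_zero h12 h13 (by linarith) hs
    rw [a, b] at kv
    exact fin ⟨r1 v1 (by linarith), a, b⟩
  rcases le_total 0 (g 0) with a | a
  · rcases le_total 0 (g 1) with b | b
    · exact case3 (Or.inl ⟨a, b⟩)
    · rcases le_total 0 (g 2) with c | c
      · exact case2 (Or.inl ⟨a, c⟩)
      · exact case1 (Or.inr ⟨b, c⟩)
  · rcases le_total 0 (g 1) with b | b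
    · rcases le_total 0 (g 2) with c | c
      · exact case1 (Or.inl ⟨b, c⟩)
      · exact case2 (Or.inr ⟨a, c⟩)
    · exact case3 (Or.inr ⟨a, b⟩)

/-- the points of `W` on the plane `⟪u, ·⟫ = 1` -/
def Fc (W : Finset (Euc 3)) (u : Euc 3) : Finset (Euc 3) := W.filter fun w => ⟪u, w⟫ = 1

def IsFc (W : Finset (Euc 3)) (u : Euc 3) : Prop :=
  (∀ w ∈ W, ⟪u, w⟫ ≤ 1) ∧ 2 < (Fc W u).card

theorem mem_Fc {W : Finset (Euc 3)} {u w : Euc 3} : w ∈ Fc W u ↔ w ∈ W ∧ ⟪u, w⟫ = 1 := by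
  simp [Fc]

theorem eq_of_three {u u' x y z : Euc 3} (hx : ⟪x, x⟫ = 1) (hy : ⟪y, y⟫ = 1) (hz : ⟪z, z⟫ = 1)
    (hxy : x ≠ y) (hxz : x ≠ z) (hyz : y ≠ z)
    (ux : ⟪u, x⟫ = 1) (uy : ⟪u, y⟫ = 1) (uz : ⟪u, z⟫ = 1)
    (ux' : ⟪u', x⟫ = 1) (uy' : ⟪u', y⟫ = 1) (uz' : ⟪u', z⟫ = 1) : u = u' := by
  have := perp3 (g := u - u') (li3 hx hy hz ux uy uz hxy hxz hyz)
    (by rw [inner_sub_left]; linarith) (by rw [inner_sub_left]; linarith)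
    (by rw [inner_sub_left]; linarith)
  exact sub_eq_zero.mp this

theorem fc_inj {W : Finset (Euc 3)} (hW : ∀ w ∈ W, ⟪w, w⟫ = 1) {u u' : Euc 3}
    (hu : IsFc W u) (h : ∀ w ∈ Fc W u, ⟪u', w⟫ = 1) : u = u' := by
  obtain ⟨x, y, z, hx, hy, hz, hxy, hxz, hyz⟩ := Finset.two_lt_card_iff.mp hu.2
  have h1 := mem_Fc.mp hx
  have h2 := mem_Fc.mp hy
  have h3 := mem_Fc.mp hz
  exact eq_of_three (hW _ h1.1) (hW _ h2.1) (hW _ h3.1) hxy hxz hyz h1.2 h2.2 h3.2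
    (h _ hx) (h _ hy) (h _ hz)

theorem fcs_finite {W : Finset (Euc 3)} (hW : ∀ w ∈ W, ⟪w, w⟫ = 1) : {u | IsFc W u}.Finite := by
  apply Set.Finite.of_finite_image (f := fun u => Fc W u)
  · apply (W.powerset.finite_toSet).subset
    rintro _ ⟨u, _, rfl⟩
    exact Finset.mem_coe.mpr (Finset.mem_powerset.mpr (Finset.filter_subset _ _))
  · intro u hu u' hu' h
    refine fc_inj hW hu ?_
    intro w hw
    have h : Fc W u = Fc W u' := h
    rw [h] at hw
    exact (mem_Fc.mp hw).2

/-- the finite set of (normals of) facets -/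
def Fcs (W : Finset (Euc 3)) : Finset (Euc 3) :=
  if h : {u | IsFc W u}.Finite then h.toFinset else ∅

theorem mem_Fcs {W : Finset (Euc 3)} (hW : ∀ w ∈ W, ⟪w, w⟫ = 1) {u : Euc 3} :
    u ∈ Fcs W ↔ IsFc W u := by
  simp [Fcs, fcs_finite hW]

theorem exists_generic (W : Finset (Euc 3)) :
    ∃ f : Euc 3, f ≠ 0 ∧ ∀ x ∈ W, ∀ y ∈ W, ⟪f, x⟫ = ⟪f, y⟫ → x = y := by
  obtain ⟨e0, he0, -⟩ := exists_perp (0 : Euc 3) 0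
  let ι := Option {p : W × W // p.1 ≠ p.2}
  let F : ι → Module.Dual ℝ (Euc 3) := fun i => match i with
    | none => innerₛₗ ℝ e0
    | some p => innerₛₗ ℝ (p.1.1.1 - p.1.2.1)
  obtain ⟨f, hf⟩ := Module.Dual.exists_forall_ne_zero_of_forall_exists F (by
    intro i
    match i with
    | none => exact ⟨e0, by simpa [F] using he0⟩
    | some p =>
      refine ⟨(p.1.1.1 - p.1.2.1), ?_⟩
      have : (p.1.1.1 : Euc 3) - p.1.2.1 ≠ 0 := by
        intro h; exact p.2 (Subtype.ext (sub_eq_zero.mp h))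
      change ⟪(p.1.1.1 : Euc 3) - p.1.2.1, p.1.1.1 - p.1.2.1⟫ ≠ 0
      simpa using this)
  refine ⟨f, ?_, ?_⟩
  · rintro rfl; exact hf none (by simp)
  · intro x hx y hy hxy
    by_contra hne
    apply hf (some ⟨(⟨x, hx⟩, ⟨y, hy⟩), fun h => hne (congrArg Subtype.val h)⟩)
    change ⟪x - y, f⟫ = 0
    rw [inner_sub_left, real_inner_comm, real_inner_comm f y]; linarith

/-- at most two faces have `v` as an `f`-middle vertex -/
theorem mid_le_two {W : Finset (Euc 3)} (hW : ∀ w ∈ W, ⟪w, w⟫ = 1) {f : Euc 3} (hf : f ≠ 0)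
    (v : Euc 3) (hv : v ∈ W) :
    ((Fcs W).filter fun u => v ∈ Fc W u ∧ (∃ a ∈ Fc W u, ⟪f, v⟫ < ⟪f, a⟫) ∧
      (∃ b ∈ Fc W u, ⟪f, b⟫ < ⟪f, v⟫)).card ≤ 2 := by
  by_contra hcon
  push Not at hcon
  obtain ⟨u1, u2, u3, h1, h2, h3, h12, h13, h23⟩ := Finset.two_lt_card_iff.mp hcon
  -- direction for each face
  have key : ∀ u, u ∈ ((Fcs W).filter fun u => v ∈ Fc W u ∧ (∃ a ∈ Fc W u, ⟪f, v⟫ < ⟪f, a⟫) ∧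
      (∃ b ∈ Fc W u, ⟪f, b⟫ < ⟪f, v⟫)) → ∃ d : Euc 3, ⟪d, v⟫ < 0 ∧ ⟪d, f⟫ = 0 ∧
      ⟪-u, d⟫ = 0 ∧ ∀ u', IsFc W u' → v ∈ Fc W u' → u' ≠ u → 0 < ⟪-u', d⟫ := by
    intro u hu
    simp only [Finset.mem_filter, mem_Fcs hW] at hu
    obtain ⟨hu, hvu, ⟨a, ha, hfa⟩, ⟨b, hb, hfb⟩⟩ := hu
    rw [mem_Fc] at ha hb hvu
    have hav : v ≠ a := by rintro rfl; exact lt_irrefl _ hfa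
    have hbv : v ≠ b := by rintro rfl; exact lt_irrefl _ hfb
    have hab : a ≠ b := by rintro rfl; linarith
    set α := ⟪f, v⟫ - ⟪f, b⟫ with hα
    set β := ⟪f, a⟫ - ⟪f, v⟫ with hβ
    have hα0 : 0 < α := by linarith
    have hβ0 : 0 < β := by linarith
    have iva := inner_lt_one' (hW _ hv) (hW _ ha.1) hav
    have ivb := inner_lt_one' (hW _ hv) (hW _ hb.1) hbv
    have ex : ∀ t : Euc 3, ⟪t, α • (a - v) + β • (b - v)⟫ =
        α * (⟪t, a⟫ - ⟪t, v⟫) + β * (⟪t, b⟫ - ⟪t, v⟫) := by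
      intro t; simp [inner_add_right, inner_smul_right, inner_sub_right]
    refine ⟨α • (a - v) + β • (b - v), ?_, ?_, ?_, ?_⟩
    · rw [real_inner_comm, ex, hW _ hv]
      nlinarith
    · rw [real_inner_comm, ex, hα, hβ]; ring
    · rw [ex]; simp [ha.2, hb.2, hvu.2]
    · intro u' hu' hvu' hne
      rw [mem_Fc] at hvu'
      rw [ex]
      have a1 := hu'.1 a ha.1
      have b1 := hu'.1 b hb.1
      simp only [inner_neg_left, hvu'.2]
      have a2 : 0 ≤ 1 - ⟪u', a⟫ := by linarith
      have b2 : 0 ≤ 1 - ⟪u', b⟫ := by linarith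
      by_contra hc
      have p1 := mul_nonneg hα0.le a2
      have p2 := mul_nonneg hβ0.le b2
      have q1 : α * (1 - ⟪u', a⟫) = 0 := by linarith
      have q2 : β * (1 - ⟪u', b⟫) = 0 := by linarith
      have r1 := (mul_eq_zero.mp q1).resolve_left hα0.ne'
      have r2 := (mul_eq_zero.mp q2).resolve_left hβ0.ne'
      exact hne (eq_of_three (hW _ hv) (hW _ ha.1) (hW _ hb.1) hav hbv hab hvu'.2
        (by linarith) (by linarith) hvu.2 ha.2 hb.2)
  have g1 := h1
  have g2 := h2
  have g3 := h3
  simp only [Finset.mem_filter, mem_Fcs hW] at g1 g2 g3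
  obtain ⟨d1, a1, b1, c1, e1⟩ := key u1 h1
  obtain ⟨d2, a2, b2, c2, e2⟩ := key u2 h2
  obtain ⟨d3, a3, b3, c3, e3⟩ := key u3 h3
  exact three_dirs hf a1 a2 a3 b1 b2 b3 c1 c2 c3
    (e2 u1 g1.1 g1.2.1 h12) (e3 u1 g1.1 g1.2.1 h13) (e1 u2 g2.1 g2.2.1 h12.symm)
    (e3 u2 g2.1 g2.2.1 h23) (e1 u3 g3.1 g3.2.1 h13.symm) (e2 u3 g3.1 g3.2.1 h23.symm)

/-- at most two face-edges at each vertex of a face -/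
theorem deg_le_two {W : Finset (Euc 3)} (hW : ∀ w ∈ W, ⟪w, w⟫ = 1) {u v : Euc 3}
    (hu : IsFc W u) (hv : v ∈ Fc W u) :
    ((Fc W u).filter fun x => x ≠ v ∧ ∃ u' ∈ Fcs W, u' ≠ u ∧ v ∈ Fc W u' ∧ x ∈ Fc W u').card
      ≤ 2 := by
  by_contra hcon
  push Not at hcon
  obtain ⟨x1, x2, x3, h1, h2, h3, h12, h13, h23⟩ := Finset.two_lt_card_iff.mp hcon
  simp only [Finset.mem_filter, mem_Fcs hW] at h1 h2 h3
  rw [mem_Fc] at hv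
  have hu0 : u ≠ 0 := by
    rintro rfl; simp at hv
  have neg : ∀ x, x ∈ Fc W u → x ≠ v → ⟪x - v, v⟫ < 0 ∧ ⟪x - v, u⟫ = 0 := by
    intro x hx hxv
    rw [mem_Fc] at hx
    have := inner_lt_one' (hW _ hx.1) (hW _ hv.1) hxv
    rw [inner_sub_left, inner_sub_left, hW _ hv.1, real_inner_comm u x, real_inner_comm u v, hx.2,
      hv.2]
    constructor <;> linarith
  obtain ⟨hx1, hxv1, w1, hw1, hwu1, hvw1, hxw1⟩ := h1
  obtain ⟨hx2, hxv2, w2, hw2, hwu2, hvw2, hxw2⟩ := h2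
  obtain ⟨hx3, hxv3, w3, hw3, hwu3, hvw3, hxw3⟩ := h3
  have zer : ∀ x w, x ∈ Fc W u → v ∈ Fc W w → x ∈ Fc W w → ⟪u - w, x - v⟫ = 0 := by
    intro x w h1 h2 h3
    rw [mem_Fc] at h1 h2 h3
    simp only [inner_sub_left, inner_sub_right, h1.2, h2.2, h3.2, hv.2]; ring
  have pos : ∀ x y w, IsFc W w → w ≠ u → x ∈ Fc W u → v ∈ Fc W w → x ∈ Fc W w → x ≠ v → y ≠ v →
      y ∈ Fc W u → x ≠ y → 0 < ⟪u - w, y - v⟫ := by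
    intro x y w hw hwu hx hvw hxw hxv hyv hy hxy
    rw [mem_Fc] at hx hvw hxw hy
    simp only [inner_sub_left, inner_sub_right, hy.2, hv.2, hvw.2]
    have := hw.1 y hy.1
    rcases this.lt_or_eq with h | h
    · linarith
    · exact absurd (eq_of_three (hW _ hv.1) (hW _ hx.1) (hW _ hy.1) hxv.symm hyv.symm hxy
        hvw.2 hxw.2 h hv.2 hx.2 hy.2) hwu
  exact three_dirs (v := v) hu0 (neg _ hx1 hxv1).1 (neg _ hx2 hxv2).1 (neg _ hx3 hxv3).1
    (neg _ hx1 hxv1).2 (neg _ hx2 hxv2).2 (neg _ hx3 hxv3).2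
    (zer _ _ hx1 hvw1 hxw1) (zer _ _ hx2 hvw2 hxw2) (zer _ _ hx3 hvw3 hxw3)
    (pos _ _ _ hw1 hwu1 hx1 hvw1 hxw1 hxv1 hxv2 hx2 h12)
    (pos _ _ _ hw1 hwu1 hx1 hvw1 hxw1 hxv1 hxv3 hx3 h13)
    (pos _ _ _ hw2 hwu2 hx2 hvw2 hxw2 hxv2 hxv1 hx1 h12.symm)
    (pos _ _ _ hw2 hwu2 hx2 hvw2 hxw2 hxv2 hxv3 hx3 h23)
    (pos _ _ _ hw3 hwu3 hx3 hvw3 hxw3 hxv3 hxv1 hx1 h13.symm)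
    (pos _ _ _ hw3 hwu3 hx3 hvw3 hxw3 hxv3 hxv2 hx2 h23.symm)

/-- central projection from `v` to the plane orthogonal to `v` -/
def pr (v x : Euc 3) : Euc 3 := (1 / (1 - ⟪x, v⟫)) • (x - v) + v

theorem pr_perp {v x : Euc 3} (hv : ⟪v, v⟫ = 1) (hx : ⟪x, x⟫ = 1) (h : x ≠ v) :
    ⟪pr v x, v⟫ = 0 := by
  have h1 := inner_lt_one' hx hv h
  have h2 : 1 - ⟪x, v⟫ ≠ 0 := by linarith
  simp only [pr, inner_add_left, inner_smul_left, inner_sub_left, hv, RCLike.conj_to_real]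
  field_simp
  ring

theorem pr_inner (v x u : Euc 3) (hu : ⟪u, v⟫ = 1) :
    ⟪u, pr v x⟫ = 1 - (1 / (1 - ⟪x, v⟫)) * (1 - ⟪u, x⟫) := by
  simp only [pr, inner_add_right, inner_smul_right, inner_sub_right, hu]
  ring

theorem pr_neg {v x z : Euc 3} (hv : ⟪v, v⟫ = 1) (hx : ⟪x, x⟫ = 1) (hz : ⟪z, z⟫ = 1)
    (h : x ≠ v) (h' : z ≠ v) (hxz : ⟪x - v, z - v⟫ ≤ 0) : ⟪pr v x, pr v z⟫ < 0 := by
  have h1 := inner_lt_one' hx hv h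
  have h2 := inner_lt_one' hz hv h'
  have e1 : ⟪pr v x, pr v z⟫ =
      (1 / (1 - ⟪x, v⟫)) * (1 / (1 - ⟪z, v⟫)) * ⟪x - v, z - v⟫ - 1 := by
    have a : 1 - ⟪x, v⟫ ≠ 0 := by linarith
    have b : 1 - ⟪z, v⟫ ≠ 0 := by linarith
    simp only [pr, inner_add_left, inner_smul_left, inner_add_right, inner_smul_right,
      inner_sub_left, inner_sub_right, hv, RCLike.conj_to_real, real_inner_comm z v]
    field_simp
    ring
  have p : 0 < (1 / (1 - ⟪x, v⟫)) * (1 / (1 - ⟪z, v⟫)) := by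
    apply mul_pos <;> apply one_div_pos.mpr <;> linarith
  rw [e1]
  nlinarith

theorem axis_comb {e1 e2 X Z u : Euc 3} {x1 x2 z1 z2 : ℝ} (hX : X = x1 • e1 + x2 • e2)
    (hZ : Z = z1 • e1 + z2 • e2) (h : x1 * z1 < 0) (uX : ⟪u, X⟫ = 1) (uZ : ⟪u, Z⟫ = 1) :
    ∃ α β : ℝ, 0 < α ∧ 0 < β ∧ (e2 = α • X + β • Z ∨ -e2 = α • X + β • Z) := by
  have hx0 : x1 ≠ 0 := by rintro rfl; simp at h
  have hz0 : z1 ≠ 0 := by rintro rfl; simp at h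
  have ax := abs_pos.mpr hx0
  have az := abs_pos.mpr hz0
  set s := |z1| * x2 + |x1| * z2 with hs
  have e0 : |z1| * x1 + |x1| * z1 = 0 := by
    rcases lt_or_gt_of_ne hx0 with h1 | h1
    · have : 0 < z1 := by nlinarith
      rw [abs_of_neg h1, abs_of_pos this]; ring
    · have : z1 < 0 := by nlinarith
      rw [abs_of_pos h1, abs_of_neg this]; ring
  have e : |z1| • X + |x1| • Z = s • e2 := by
    have : |z1| • X + |x1| • Z = (|z1| * x1 + |x1| * z1) • e1 + s • e2 := by
      rw [hX, hZ, hs]; module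
    rw [this, e0]; simp
  have es : s * ⟪u, e2⟫ = |z1| + |x1| := by
    have := congrArg (fun t => ⟪u, t⟫) e
    simp only [inner_add_right, inner_smul_right, uX, uZ] at this
    linarith
  have hs0 : s ≠ 0 := by intro h0; rw [h0] at es; linarith
  have as := abs_pos.mpr hs0
  refine ⟨|z1| / |s|, |x1| / |s|, div_pos az as, div_pos ax as, ?_⟩
  have e' : (|z1| / |s|) • X + (|x1| / |s|) • Z = (s / |s|) • e2 := by
    have : (|z1| / |s|) • X + (|x1| / |s|) • Z = |s|⁻¹ • (|z1| • X + |x1| • Z) := by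
      rw [smul_add, smul_smul, smul_smul]; congr 2 <;> ring
    rw [this, e, smul_smul]; congr 1; ring
  rw [e']
  rcases lt_or_gt_of_ne hs0 with h1 | h1
  · right; rw [abs_of_neg h1, div_neg, div_self hs0]; simp
  · left; rw [abs_of_pos h1, div_self hs0]; simp

def Obt (W : Finset (Euc 3)) (v u : Euc 3) : Prop :=
  v ∈ Fc W u ∧ ∃ x z : Euc 3, x ∈ Fc W u ∧ z ∈ Fc W u ∧ x ≠ v ∧ z ≠ v ∧ ⟪x - v, z - v⟫ ≤ 0

theorem obt_le_three {W : Finset (Euc 3)} (hW : ∀ w ∈ W, ⟪w, w⟫ = 1) (v : Euc 3) (hv : v ∈ W) :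
    ((Fcs W).filter fun u => Obt W v u).card ≤ 3 := by
  rcases ((Fcs W).filter fun u => Obt W v u).eq_empty_or_nonempty with h | ⟨u0, hu0⟩
  · rw [h]; simp
  have hmem : ∀ u, u ∈ ((Fcs W).filter fun u => Obt W v u) ↔ IsFc W u ∧ Obt W v u := by
    intro u; rw [Finset.mem_filter, mem_Fcs hW]
  have hch : ∀ u, ∃ xz : Euc 3 × Euc 3, Obt W v u → (xz.1 ∈ Fc W u ∧ xz.2 ∈ Fc W u ∧ xz.1 ≠ v ∧
      xz.2 ≠ v ∧ ⟪xz.1 - v, xz.2 - v⟫ ≤ 0) := by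
    intro u
    by_cases h : Obt W v u
    · obtain ⟨x, z, h2⟩ := h.2
      exact ⟨(x, z), fun _ => h2⟩
    · exact ⟨(0, 0), fun h' => absurd h' h⟩
  choose XZ hXZ using hch
  have hv1 := hW v hv
  have prle : ∀ u x, IsFc W u → v ∈ Fc W u → x ∈ W → x ≠ v →
      ⟪u, pr v x⟫ ≤ 1 ∧ (⟪u, pr v x⟫ = 1 → ⟪u, x⟫ = 1) := by
    intro u x hu hvu hx hxv
    rw [pr_inner _ _ _ (mem_Fc.mp hvu).2]
    have h1 := inner_lt_one' (hW _ hx) hv1 hxv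
    have h2 : 0 < 1 / (1 - ⟪x, v⟫) := one_div_pos.mpr (by linarith)
    have h3 := hu.1 x hx
    constructor
    · have := mul_nonneg h2.le (by linarith : 0 ≤ 1 - ⟪u, x⟫)
      linarith
    · intro h4
      have : 1 / (1 - ⟪x, v⟫) * (1 - ⟪u, x⟫) = 0 := by linarith
      have := (mul_eq_zero.mp this).resolve_left h2.ne'
      linarith
  have preq : ∀ u x, v ∈ Fc W u → x ∈ Fc W u → ⟪u, pr v x⟫ = 1 := by
    intro u x hvu hx
    rw [pr_inner _ _ _ (mem_Fc.mp hvu).2, (mem_Fc.mp hx).2]; simp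
  -- direction comparison
  have dir_le : ∀ u u' e, IsFc W u → Obt W v u → IsFc W u' → v ∈ Fc W u' →
      (∃ α β : ℝ, 0 < α ∧ 0 < β ∧ e = α • pr v (XZ u).1 + β • pr v (XZ u).2) →
      ⟪u', e⟫ ≤ ⟪u, e⟫ ∧ (⟪u', e⟫ = ⟪u, e⟫ → u' = u) := by
    rintro u u' e hu hou hu' hvu' ⟨α, β, hα, hβ, rfl⟩
    obtain ⟨hx, hz, hxv, hzv, hxz⟩ := hXZ u hou
    have hxW := (mem_Fc.mp hx).1
    have hzW := (mem_Fc.mp hz).1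
    simp only [inner_add_right, inner_smul_right]
    rw [preq u _ hou.1 hx, preq u _ hou.1 hz]
    have a1 := prle u' _ hu' hvu' hxW hxv
    have a2 := prle u' _ hu' hvu' hzW hzv
    have m1 := mul_nonneg hα.le (by linarith [a1.1] : 0 ≤ 1 - ⟪u', pr v (XZ u).1⟫)
    have m2 := mul_nonneg hβ.le (by linarith [a2.1] : 0 ≤ 1 - ⟪u', pr v (XZ u).2⟫)
    constructor
    · linarith
    · intro h
      have n1 : α * (1 - ⟪u', pr v (XZ u).1⟫) = 0 := by linarith
      have n2 : β * (1 - ⟪u', pr v (XZ u).2⟫) = 0 := by linarith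
      have o1 := (mul_eq_zero.mp n1).resolve_left hα.ne'
      have o2 := (mul_eq_zero.mp n2).resolve_left hβ.ne'
      have q1 := a1.2 (by linarith)
      have q2 := a2.2 (by linarith)
      have hne : (XZ u).1 ≠ (XZ u).2 := by
        intro h
        rw [h] at hxz
        have := real_inner_self_pos.mpr (sub_ne_zero.mpr hzv)
        linarith
      exact eq_of_three hv1 (hW _ hxW) (hW _ hzW) hxv.symm hzv.symm hne (mem_Fc.mp hvu').2 q1 q2
        (mem_Fc.mp hou.1).2 (mem_Fc.mp hx).2 (mem_Fc.mp hz).2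
  obtain ⟨hu0, ho0⟩ := (hmem u0).mp hu0
  obtain ⟨hx0, hz0, hxv0, hzv0, hxz0⟩ := hXZ u0 ho0
  set e1 := pr v (XZ u0).1 with he1
  have ue1 : ⟪u0, e1⟫ = 1 := preq u0 _ ho0.1 hx0
  have e1ne : e1 ≠ 0 := by intro h; rw [h] at ue1; simp at ue1
  have e1v : ⟪e1, v⟫ = 0 := pr_perp hv1 (hW _ (mem_Fc.mp hx0).1) hxv0
  obtain ⟨e2, e2ne, e2v, e21⟩ := exists_perp v e1
  have vne : v ≠ 0 := by rintro rfl; simp at hv1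
  have e11 := real_inner_self_pos.mpr e1ne
  have e22 := real_inner_self_pos.mpr e2ne
  have expand : ∀ Y : Euc 3, ⟪Y, v⟫ = 0 → ∃ a b : ℝ, Y = a • e1 + b • e2 := by
    intro Y hY
    refine ⟨⟪Y, e1⟫ / ⟪e1, e1⟫, ⟪Y, e2⟫ / ⟪e2, e2⟫, ?_⟩
    rw [← sub_eq_zero]
    refine perp_orth e1ne e2ne vne (by rw [real_inner_comm]; exact e21) e1v e2v ?_ ?_ ?_
    · simp only [inner_sub_left, inner_add_left, inner_smul_left, RCLike.conj_to_real, e21]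
      field_simp; ring
    · simp only [inner_sub_left, inner_add_left, inner_smul_left, RCLike.conj_to_real,
        real_inner_comm e2 e1, e21]
      field_simp; ring
    · simp only [inner_sub_left, inner_add_left, inner_smul_left, RCLike.conj_to_real,
        hY, e1v, e2v]
      ring
  have exdir : ∀ u, ∃ e : Euc 3, u ∈ ((Fcs W).filter fun u => Obt W v u) →
      e ∈ ({-e1, e2, -e2} : Finset (Euc 3)) ∧
      ∃ α β : ℝ, 0 < α ∧ 0 < β ∧ e = α • pr v (XZ u).1 + β • pr v (XZ u).2 := by
    intro u
    by_cases hu : u ∈ ((Fcs W).filter fun u => Obt W v u)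
    swap
    · exact ⟨0, fun h => absurd h hu⟩
    obtain ⟨hu, ho⟩ := (hmem u).mp hu
    obtain ⟨hx, hz, hxv, hzv, hxz⟩ := hXZ u ho
    have hx1 := hW _ (mem_Fc.mp hx).1
    have hz1 := hW _ (mem_Fc.mp hz).1
    obtain ⟨x1, x2, hX⟩ := expand _ (pr_perp hv1 hx1 hxv)
    obtain ⟨z1, z2, hZ⟩ := expand _ (pr_perp hv1 hz1 hzv)
    have hneg := pr_neg hv1 hx1 hz1 hxv hzv hxz
    have hdot : ⟪pr v (XZ u).1, pr v (XZ u).2⟫ = x1 * z1 * ⟪e1, e1⟫ + x2 * z2 * ⟪e2, e2⟫ := by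
      rw [hX, hZ]
      simp only [inner_add_left, inner_smul_left, inner_add_right, inner_smul_right,
        RCLike.conj_to_real, real_inner_comm e2 e1, e21]
      ring
    have uX := preq u _ ho.1 hx
    have uZ := preq u _ ho.1 hz
    by_cases h1 : x1 * z1 < 0
    · obtain ⟨α, β, hα, hβ, h | h⟩ := axis_comb hX hZ h1 uX uZ
      · exact ⟨e2, fun _ => ⟨by simp, α, β, hα, hβ, h⟩⟩
      · exact ⟨-e2, fun _ => ⟨by simp, α, β, hα, hβ, h⟩⟩
    · have h2 : x2 * z2 < 0 := by
        by_contra h3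
        push Not at h1 h3
        have := mul_nonneg h1 e11.le
        have := mul_nonneg h3 e22.le
        linarith
      obtain ⟨α, β, hα, hβ, h | h⟩ := axis_comb (hX.trans (add_comm _ _))
        (hZ.trans (add_comm _ _)) h2 uX uZ
      · exfalso
        obtain ⟨l1, l2⟩ := dir_le u u0 e1 hu ho hu0 ho0.1 ⟨α, β, hα, hβ, h⟩
        have l3 := (prle u _ hu ho.1 (mem_Fc.mp hx0).1 hxv0).1
        have l4 := l2 (by rw [← he1] at l3; linarith)
        subst l4
        rw [← he1] at h
        have s1 := congrArg (fun t => ⟪u0, t⟫) h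
        simp only [inner_add_right, inner_smul_right, ue1, uZ] at s1
        have s2 : β • (e1 - pr v (XZ u0).2) = 0 := by
          have : α = 1 - β := by linarith
          rw [this] at h
          rw [smul_sub, sub_eq_zero]
          have h3 : e1 = e1 - β • e1 + β • pr v (XZ u0).2 := by
            conv_lhs => rw [h]
            module
          have h4 : β • e1 = e1 - (e1 - β • e1) := by abel
          rw [h4]
          nth_rewrite 1 [h3]
          abel
        have s3 := (smul_eq_zero.mp s2).resolve_left hβ.ne'
        rw [sub_eq_zero] at s3
        rw [← he1, ← s3] at hneg
        linarith
      · exact ⟨-e1, fun _ => ⟨by simp, α, β, hα, hβ, h⟩⟩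
  choose g hg using exdir
  calc _ ≤ ({-e1, e2, -e2} : Finset (Euc 3)).card := by
        apply Finset.card_le_card_of_injOn g
        · intro u hu; exact (hg u hu).1
        · intro u hu u' hu' he
          have h1 := (hg u hu).2
          have h2 := (hg u' hu').2
          obtain ⟨k1, k2⟩ := (hmem u).mp hu
          obtain ⟨k3, k4⟩ := (hmem u').mp hu'
          have a := dir_le u u' _ k1 k2 k3 k4.1 h1
          have b := dir_le u' u _ k3 k4 k1 k2.1 h2
          rw [← he] at b
          exact (a.2 (le_antisymm a.1 b.1)).symm
    _ ≤ 3 := Finset.card_le_three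

/-- ordered Gabriel pairs -/
def Gab (W : Finset (Euc 3)) : Finset (Euc 3 × Euc 3) :=
  (W ×ˢ W).filter fun p => p.1 ≠ p.2 ∧ p.1 ≠ -p.2 ∧ ∀ w ∈ W, ⟪p.1 + p.2, w⟫ ≤ 1 + ⟪p.1, p.2⟫

theorem mem_Gab {W : Finset (Euc 3)} {a b : Euc 3} : (a, b) ∈ Gab W ↔ (a ∈ W ∧ b ∈ W) ∧ a ≠ b ∧
    a ≠ -b ∧ ∀ w ∈ W, ⟪a + b, w⟫ ≤ 1 + ⟪a, b⟫ := by
  simp [Gab]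

/-- partner of `v` on the circle of the plane `u` -/
def par (u v : Euc 3) : Euc 3 := (2 / ⟪u, u⟫) • u - v

theorem par_par (u v : Euc 3) : par u (par u v) = v := by simp [par]

theorem half_rot {W : Finset (Euc 3)} {m a b c : Euc 3}
    (hm : ∀ w ∈ W, ⟪m, w⟫ ≤ 1) (ha : a ∈ W) (hb : b ∈ W) (hab : a ≠ b) (ma : ⟪m, a⟫ = 1)
    (mb : ⟪m, b⟫ = 1) (ca : ⟪c, a⟫ = 0) (cb : ⟪c, b⟫ = 0) (hc : ∃ w ∈ W, 0 < ⟪c, w⟫) :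
    ∃ t : ℝ, 0 ≤ t ∧ IsFc W (m + t • c) ∧ a ∈ Fc W (m + t • c) ∧ b ∈ Fc W (m + t • c) ∧
      ∃ w ∈ Fc W (m + t • c), 0 < ⟪c, w⟫ := by
  obtain ⟨w0, hw0, hcw0⟩ := hc
  obtain ⟨w1, hw1, hmin⟩ := (W.filter fun w => 0 < ⟪c, w⟫).exists_min_image
    (fun w => (1 - ⟪m, w⟫) / ⟪c, w⟫) ⟨w0, by simp [hw0, hcw0]⟩
  rw [Finset.mem_filter] at hw1
  set t := (1 - ⟪m, w1⟫) / ⟪c, w1⟫ with ht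
  have ht0 : 0 ≤ t := div_nonneg (by linarith [hm w1 hw1.1]) hw1.2.le
  have ex : ∀ w, ⟪m + t • c, w⟫ = ⟪m, w⟫ + t * ⟪c, w⟫ := by
    intro w; simp [inner_add_left, inner_smul_left]
  have haF : a ∈ Fc W (m + t • c) := mem_Fc.mpr ⟨ha, by rw [ex, ma, ca]; simp⟩
  have hbF : b ∈ Fc W (m + t • c) := mem_Fc.mpr ⟨hb, by rw [ex, mb, cb]; simp⟩
  have hwF : w1 ∈ Fc W (m + t • c) := mem_Fc.mpr ⟨hw1.1, by
    rw [ex, ht, div_mul_cancel₀ _ hw1.2.ne']; ring⟩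
  refine ⟨t, ht0, ⟨?_, ?_⟩, haF, hbF, w1, hwF, hw1.2⟩
  · intro w hw
    rw [ex]
    by_cases h : 0 < ⟪c, w⟫
    · have h1 := hmin w (by simp [hw, h])
      have h2 : t * ⟪c, w⟫ ≤ (1 - ⟪m, w⟫) / ⟪c, w⟫ * ⟪c, w⟫ := by gcongr
      rw [div_mul_cancel₀ _ h.ne'] at h2
      linarith
    · push Not at h
      have := mul_nonneg ht0 (neg_nonneg.mpr h)
      linarith [hm w hw]
  · rw [Finset.two_lt_card_iff]
    refine ⟨a, b, w1, haF, hbF, hwF, hab, ?_, ?_⟩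
    · rintro rfl; linarith [hw1.2]
    · rintro rfl; linarith [hw1.2]

theorem gab_faces {W : Finset (Euc 3)} (hW : ∀ w ∈ W, ⟪w, w⟫ = 1) (hneg : ∀ w ∈ W, -w ∈ W)
    (hS : ∀ x : Euc 3, (∀ w ∈ W, ⟪x, w⟫ = 0) → x = 0) {a b : Euc 3} (h : (a, b) ∈ Gab W) :
    (∃ u ∈ Fcs W, ∃ u' ∈ Fcs W, u ≠ u' ∧ a ∈ Fc W u ∧ b ∈ Fc W u ∧ a ∈ Fc W u' ∧ b ∈ Fc W u') ∨
    (∃ u ∈ Fcs W, 4 ≤ (Fc W u).card ∧ a ∈ Fc W u ∧ b ∈ Fc W u ∧ b = par u a) := by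
  obtain ⟨⟨ha, hb⟩, hab, hab', hg⟩ := mem_Gab.mp h
  have ha1 := hW a ha
  have hb1 := hW b hb
  have hpos : 0 < 1 + ⟪a, b⟫ := by
    have := inner_lt_one' ha1 (hW _ (hneg b hb)) hab'
    rw [inner_neg_right] at this
    linarith
  set s := 1 + ⟪a, b⟫ with hs
  set m : Euc 3 := s⁻¹ • (a + b) with hm
  have mi : ∀ w, ⟪m, w⟫ = s⁻¹ * ⟪a + b, w⟫ := by
    intro w; rw [hm, inner_smul_left, RCLike.conj_to_real]
  have mle : ∀ w ∈ W, ⟪m, w⟫ ≤ 1 := by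
    intro w hw
    rw [mi]
    have : s⁻¹ * ⟪a + b, w⟫ ≤ s⁻¹ * s := by
      have := hg w hw
      have := (inv_pos.mpr hpos).le
      gcongr
    rwa [inv_mul_cancel₀ hpos.ne'] at this
  have ma : ⟪m, a⟫ = 1 := by
    rw [mi, inner_add_left, ha1, real_inner_comm a b, ← hs, inv_mul_cancel₀ hpos.ne']
  have mb : ⟪m, b⟫ = 1 := by
    rw [mi, inner_add_left, hb1, add_comm, ← hs, inv_mul_cancel₀ hpos.ne']
  obtain ⟨c, hc0, hca, hcb⟩ := exists_perp a b
  have hcw : ∃ w ∈ W, ⟪c, w⟫ ≠ 0 := by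
    by_contra hcon
    push Not at hcon
    exact hc0 (hS c hcon)
  have both : (∃ w ∈ W, 0 < ⟪c, w⟫) ∧ (∃ w ∈ W, 0 < ⟪-c, w⟫) := by
    obtain ⟨w, hw, hcw⟩ := hcw
    rcases lt_or_gt_of_ne hcw with h | h
    · exact ⟨⟨-w, hneg w hw, by rw [inner_neg_right]; linarith⟩,
        ⟨w, hw, by rw [inner_neg_left]; linarith⟩⟩
    · exact ⟨⟨w, hw, h⟩, ⟨-w, hneg w hw, by rw [inner_neg_left, inner_neg_right]; linarith⟩⟩
  obtain ⟨t, ht, hF, haF, hbF, w, hwF, hcw⟩ := half_rot mle ha hb hab ma mb hca hcb both.1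
  obtain ⟨t', ht', hF', haF', hbF', w', hwF', hcw'⟩ := half_rot (c := -c) mle ha hb hab ma mb
    (by simp [hca]) (by simp [hcb]) both.2
  by_cases heq : m + t • c = m + t' • -c
  · right
    have h1 : (t + t') • c = 0 := by
      have := add_left_cancel heq
      rw [add_smul, this]; simp
    have h2 := (smul_eq_zero.mp h1).resolve_right hc0
    have h3 : t = 0 := by linarith
    have h4 : t' = 0 := by linarith
    subst h3 h4
    simp only [zero_smul, add_zero] at hF haF hbF hwF hwF'
    refine ⟨m, (mem_Fcs hW).mpr hF, ?_, haF, hbF, ?_⟩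
    · have hsub : ({a, b, w, w'} : Finset (Euc 3)) ⊆ Fc W m := by
        intro x hx
        simp only [Finset.mem_insert, Finset.mem_singleton] at hx
        rcases hx with rfl | rfl | rfl | rfl <;> assumption
      rw [inner_neg_left] at hcw'
      have : ({a, b, w, w'} : Finset (Euc 3)).card = 4 := by
        rw [Finset.card_insert_of_notMem, Finset.card_insert_of_notMem,
          Finset.card_insert_of_notMem, Finset.card_singleton]
        · simp only [Finset.mem_singleton]; rintro rfl; linarith
        · simp only [Finset.mem_insert, Finset.mem_singleton, not_or]
          constructor <;> (rintro rfl; linarith)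
        · simp only [Finset.mem_insert, Finset.mem_singleton, not_or]
          refine ⟨hab, ?_, ?_⟩ <;> (rintro rfl; linarith)
      rw [← this]; exact Finset.card_le_card hsub
    · have hmm : ⟪m, m⟫ = s⁻¹ * 2 := by
        rw [mi, inner_add_left, real_inner_comm m a, real_inner_comm m b, ma, mb]; norm_num
      rw [par, hmm, hm, smul_smul]
      have : 2 / (s⁻¹ * 2) * s⁻¹ = 1 := by field_simp
      rw [this]; simp
  · left
    exact ⟨_, (mem_Fcs hW).mpr hF, _, (mem_Fcs hW).mpr hF', heq, haF, hbF, haF', hbF'⟩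

def Dn (W : Finset (Euc 3)) (u : Euc 3) : ℕ :=
  if 4 ≤ (Fc W u).card then ((Fc W u).filter fun v => par u v ∈ Fc W u).card else 0

theorem gab_count {W : Finset (Euc 3)} (hW : ∀ w ∈ W, ⟪w, w⟫ = 1) (hneg : ∀ w ∈ W, -w ∈ W)
    (hS : ∀ x : Euc 3, (∀ w ∈ W, ⟪x, w⟫ = 0) → x = 0) :
    (Gab W).card ≤ ∑ u ∈ Fcs W, ((Fc W u).card + Dn W u) := by
  let A : Euc 3 × Euc 3 → Euc 3 → Prop := fun p u => p.1 ∈ Fc W u ∧ p.2 ∈ Fc W u ∧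
    ∃ u' ∈ Fcs W, u' ≠ u ∧ p.1 ∈ Fc W u' ∧ p.2 ∈ Fc W u'
  let B : Euc 3 × Euc 3 → Euc 3 → Prop := fun p u => 4 ≤ (Fc W u).card ∧ p.1 ∈ Fc W u ∧
    p.2 ∈ Fc W u ∧ p.2 = par u p.1
  have h1 : ∀ p ∈ Gab W, 2 ≤ ((Fcs W).filter (A p)).card + 2 * ((Fcs W).filter (B p)).card := by
    rintro ⟨a, b⟩ hp
    rcases gab_faces hW hneg hS hp with ⟨u, hu, u', hu', hne, h1, h2, h3, h4⟩ | ⟨u, hu, h⟩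
    · have : 1 < ((Fcs W).filter (A (a, b))).card := by
        rw [Finset.one_lt_card_iff]
        refine ⟨u, u', ?_, ?_, hne⟩
        · exact Finset.mem_filter.mpr ⟨hu, h1, h2, u', hu', hne.symm, h3, h4⟩
        · exact Finset.mem_filter.mpr ⟨hu', h3, h4, u, hu, hne, h1, h2⟩
      omega
    · have : 0 < ((Fcs W).filter (B (a, b))).card :=
        Finset.card_pos.mpr ⟨u, Finset.mem_filter.mpr ⟨hu, h⟩⟩
      omega
  have h2 : 2 * (Gab W).card ≤ ∑ p ∈ Gab W, (((Fcs W).filter (A p)).card +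
      2 * ((Fcs W).filter (B p)).card) := by
    rw [mul_comm, ← smul_eq_mul]
    exact Finset.card_nsmul_le_sum _ _ _ h1
  rw [Finset.sum_add_distrib, ← Finset.mul_sum] at h2
  have sA : ∑ p ∈ Gab W, ((Fcs W).filter (A p)).card =
      ∑ u ∈ Fcs W, ((Gab W).filter fun p => A p u).card :=
    Finset.sum_card_bipartiteAbove_eq_sum_card_bipartiteBelow A
  have sB : ∑ p ∈ Gab W, ((Fcs W).filter (B p)).card =
      ∑ u ∈ Fcs W, ((Gab W).filter fun p => B p u).card :=
    Finset.sum_card_bipartiteAbove_eq_sum_card_bipartiteBelow B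
  have cA : ∀ u ∈ Fcs W, ((Gab W).filter fun p => A p u).card ≤ 2 * (Fc W u).card := by
    intro u hu
    apply Finset.card_le_mul_card_image_of_maps_to (f := Prod.fst)
    · intro p hp
      exact (Finset.mem_filter.mp hp).2.1
    · intro v hv
      refine le_trans ?_ (deg_le_two hW ((mem_Fcs hW).mp hu) hv)
      apply Finset.card_le_card_of_injOn Prod.snd
      · rintro ⟨a, b⟩ hp
        simp only [Finset.coe_filter, Finset.mem_filter, Set.mem_ofPred_eq] at hp
        obtain ⟨⟨hp, hA1, hA2, hA3⟩, rfl⟩ := hp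
        simp only [Finset.coe_filter, Set.mem_ofPred_eq]
        exact ⟨hA2, (mem_Gab.mp hp).2.1.symm, hA3⟩
      · rintro ⟨a, b⟩ hp ⟨a', b'⟩ hp' h
        simp only [Finset.coe_filter, Finset.mem_filter, Set.mem_ofPred_eq] at hp hp'
        obtain ⟨_, rfl⟩ := hp
        obtain ⟨_, rfl⟩ := hp'
        simp only at h
        rw [h]
  have cB : ∀ u ∈ Fcs W, ((Gab W).filter fun p => B p u).card ≤ Dn W u := by
    intro u hu
    rw [Dn]
    split_ifs with hk
    · apply Finset.card_le_card_of_injOn Prod.fst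
      · rintro ⟨a, b⟩ hp
        simp only [Finset.coe_filter, Set.mem_ofPred_eq] at hp
        obtain ⟨_, _, h1, h2, h3⟩ := hp
        simp only at h1 h2 h3
        simp only [Finset.coe_filter, Set.mem_ofPred_eq]
        exact ⟨h1, h3 ▸ h2⟩
      · rintro ⟨a, b⟩ hp ⟨a', b'⟩ hp' h
        simp only [Finset.coe_filter, Set.mem_ofPred_eq] at hp hp'
        obtain ⟨_, _, _, _, h3⟩ := hp
        obtain ⟨_, _, _, _, h3'⟩ := hp'
        simp only at h h3 h3'
        rw [h3, h3', h]
    · rw [Nat.le_zero, Finset.card_eq_zero, Finset.filter_eq_empty_iff]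
      intro p _ hB
      exact hk hB.1
  have tA := Finset.sum_le_sum cA
  have tB := Finset.sum_le_sum cB
  rw [← Finset.mul_sum] at tA
  rw [Finset.sum_add_distrib]
  omega

def Rect (W : Finset (Euc 3)) (u : Euc 3) : Prop :=
  (Fc W u).card = 4 ∧ ∀ v ∈ Fc W u, par u v ∈ Fc W u

theorem par_ne {W : Finset (Euc 3)} (hW : ∀ w ∈ W, ⟪w, w⟫ = 1) {u v : Euc 3} (hu : IsFc W u)
    (hv : v ∈ Fc W u) : par u v ≠ v := by
  intro h
  have h1 : (2 / ⟪u, u⟫) • u = (2 : ℝ) • v := by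
    rw [par, sub_eq_iff_eq_add] at h; rw [h, two_smul]
  have h2 : ∀ x ∈ Fc W u, x = v := by
    intro x hx
    by_contra hne
    have e1 := congrArg (fun t => ⟪t, x⟫) h1
    have e2 := congrArg (fun t => ⟪t, v⟫) h1
    rw [mem_Fc] at hx hv
    simp only [inner_smul_left, RCLike.conj_to_real, hx.2, hv.2, hW _ hv.1] at e1 e2
    have := inner_lt_one' (hW _ hv.1) (hW _ hx.1) (Ne.symm hne)
    linarith
  obtain ⟨x, y, z, hx, hy, hz, hxy, -⟩ := Finset.two_lt_card_iff.mp hu.2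
  exact hxy ((h2 x hx).trans (h2 y hy).symm)

theorem dn_even {W : Finset (Euc 3)} (hW : ∀ w ∈ W, ⟪w, w⟫ = 1) {u : Euc 3} (hu : IsFc W u) :
    2 ∣ ((Fc W u).filter fun v => par u v ∈ Fc W u).card := by
  rw [← CharP.cast_eq_zero_iff (ZMod 2) 2, Finset.cast_card]
  apply Finset.sum_involution (fun v _ => par u v)
  · intro v hv; decide
  · intro v hv _
    exact par_ne hW hu (Finset.mem_filter.mp hv).1
  · intro v hv
    rw [Finset.mem_filter] at hv ⊢
    exact ⟨hv.2, by rw [par_par]; exact hv.1⟩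
  · intro v hv; exact par_par u v

theorem dn_le {W : Finset (Euc 3)} (hW : ∀ w ∈ W, ⟪w, w⟫ = 1) {u : Euc 3} (hu : IsFc W u) :
    Dn W u + 6 ≤ 2 * (Fc W u).card + 2 * (if Rect W u then 1 else 0) := by
  have h0 := hu.2
  have h1 := dn_even hW hu
  have h2 := Finset.card_filter_le (Fc W u) fun v => par u v ∈ Fc W u
  rw [Dn]
  split_ifs with a b b
  · omega
  · have : (Fc W u).card = 4 → ((Fc W u).filter fun v => par u v ∈ Fc W u).card ≠ 4 := by
      intro h4 h5
      apply b
      refine ⟨h4, ?_⟩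
      rw [← h4, Finset.card_filter_eq_iff] at h5
      exact h5
    omega
  · omega
  · omega

theorem sum_k {W : Finset (Euc 3)} (hW : ∀ w ∈ W, ⟪w, w⟫ = 1) (h2 : 2 ≤ W.card) :
    ∑ u ∈ Fcs W, (Fc W u).card + 4 ≤ 2 * (Fcs W).card + 2 * W.card := by
  obtain ⟨f, hf, hinj⟩ := exists_generic W
  let M : Euc 3 → Euc 3 → Prop := fun v u => v ∈ Fc W u ∧ (∃ a ∈ Fc W u, ⟪f, v⟫ < ⟪f, a⟫) ∧
      (∃ b ∈ Fc W u, ⟪f, b⟫ < ⟪f, v⟫)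
  have hk : ∀ u ∈ Fcs W, (Fc W u).card ≤ (W.filter fun v => M v u).card + 2 := by
    intro u hu
    have hu' := (mem_Fcs hW).mp hu
    have hne : (Fc W u).Nonempty := Finset.card_pos.mp (by have := hu'.2; omega)
    obtain ⟨p, hp, hpm⟩ := (Fc W u).exists_max_image (fun w => ⟪f, w⟫) hne
    obtain ⟨q, hq, hqm⟩ := (Fc W u).exists_min_image (fun w => ⟪f, w⟫) hne
    have hsub : Fc W u ⊆ (W.filter fun v => M v u) ∪ {p, q} := by
      intro v hv
      by_cases h1 : v = p
      · simp [h1]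
      by_cases h2 : v = q
      · simp [h2]
      rw [Finset.mem_union]; left
      refine Finset.mem_filter.mpr ⟨(mem_Fc.mp hv).1, hv, ⟨p, hp, ?_⟩, ⟨q, hq, ?_⟩⟩
      · exact lt_of_le_of_ne (hpm v hv)
          fun h => h1 (hinj _ (mem_Fc.mp hv).1 _ (mem_Fc.mp hp).1 h)
      · exact lt_of_le_of_ne (hqm v hv)
          fun h => h2 (hinj _ (mem_Fc.mp hq).1 _ (mem_Fc.mp hv).1 h).symm
    calc _ ≤ _ := Finset.card_le_card hsub
      _ ≤ _ := Finset.card_union_le _ _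
      _ ≤ _ := by gcongr; exact Finset.card_le_two
  have hs := Finset.sum_le_sum hk
  rw [Finset.sum_add_distrib, Finset.sum_const, smul_eq_mul] at hs
  have sM : ∑ v ∈ W, ((Fcs W).filter (M v)).card = ∑ u ∈ Fcs W, (W.filter fun v => M v u).card :=
    Finset.sum_card_bipartiteAbove_eq_sum_card_bipartiteBelow M
  have hne : W.Nonempty := Finset.card_pos.mp (by omega)
  obtain ⟨p, hp, hpm⟩ := W.exists_max_image (fun w => ⟪f, w⟫) hne
  obtain ⟨q, hq, hqm⟩ := W.exists_min_image (fun w => ⟪f, w⟫) hne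
  have hpq : p ≠ q := by
    rintro rfl
    obtain ⟨x, y, hx, hy, hxy⟩ := Finset.one_lt_card_iff.mp (by omega : 1 < W.card)
    apply hxy
    apply hinj x hx y hy
    have := hpm x hx
    have := hpm y hy
    have := hqm x hx
    have := hqm y hy
    linarith
  have hv : ∀ v ∈ W, ((Fcs W).filter (M v)).card + (if v ∈ ({p, q} : Finset (Euc 3)) then 2 else 0)
      ≤ 2 := by
    intro v hv
    split_ifs with h
    · have : (Fcs W).filter (M v) = ∅ := by
        rw [Finset.filter_eq_empty_iff]
        rintro u _ ⟨_, ⟨a, ha, h1⟩, ⟨b, hb, h2⟩⟩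
        have := hpm a (mem_Fc.mp ha).1
        have := hqm b (mem_Fc.mp hb).1
        simp only [Finset.mem_insert, Finset.mem_singleton] at h
        rcases h with rfl | rfl <;> linarith
      rw [this]; simp
    · exact mid_le_two hW hf v hv
  have hs2 := Finset.sum_le_sum hv
  rw [Finset.sum_add_distrib, ← Finset.sum_filter, Finset.sum_const, Finset.sum_const] at hs2
  have hc : (W.filter fun v => v ∈ ({p, q} : Finset (Euc 3))) = {p, q} := by
    ext x
    simp only [Finset.mem_filter, Finset.mem_insert, Finset.mem_singleton]
    constructor
    · exact fun h => h.2
    · rintro (rfl | rfl) <;> simp [*]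
  rw [hc, Finset.card_pair hpq] at hs2
  simp only [smul_eq_mul] at hs2
  omega

theorem rect_obt {W : Finset (Euc 3)} (hW : ∀ w ∈ W, ⟪w, w⟫ = 1) {u v : Euc 3} (hu : IsFc W u)
    (hr : Rect W u) (hv : v ∈ Fc W u) : ∃ x ∈ Fc W u, x ≠ v ∧ x ≠ par u v ∧
      ⟪x - v, par u x - v⟫ = 0 := by
  have : ∃ x ∈ Fc W u, x ∉ ({v, par u v} : Finset (Euc 3)) := by
    by_contra hcon
    push Not at hcon
    have h1 := Finset.card_le_card (fun x hx => hcon x hx : Fc W u ⊆ {v, par u v})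
    have h2 := Finset.card_le_two (a := v) (b := par u v)
    have h3 := hr.1
    omega
  obtain ⟨x, hx, hx2⟩ := this
  simp only [Finset.mem_insert, Finset.mem_singleton, not_or] at hx2
  refine ⟨x, hx, hx2.1, hx2.2, ?_⟩
  rw [mem_Fc] at hx hv
  simp only [par, inner_sub_left, inner_sub_right, inner_smul_right, hW _ hx.1, hW _ hv.1,
    real_inner_comm u x, real_inner_comm u v, hx.2, hv.2, real_inner_comm x v]
  ring

theorem rect_Obt {W : Finset (Euc 3)} (hW : ∀ w ∈ W, ⟪w, w⟫ = 1) {u v : Euc 3} (hu : IsFc W u)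
    (hr : Rect W u) (hv : v ∈ Fc W u) : Obt W v u := by
  obtain ⟨x, hx, h1, h2, h3⟩ := rect_obt hW hu hr hv
  refine ⟨hv, x, par u x, hx, hr.2 x hx, h1, ?_, h3.le⟩
  intro h
  apply h2
  rw [← h, par_par]

theorem core {W : Finset (Euc 3)} (hW : ∀ w ∈ W, ⟪w, w⟫ = 1) (hneg : ∀ w ∈ W, -w ∈ W)
    (hS : ∀ x : Euc 3, (∀ w ∈ W, ⟪x, w⟫ = 0) → x = 0) :
    2 * (Gab W).card + 24 ≤ 15 * W.card ∧ (15 * W.card ≤ 2 * (Gab W).card + 24 →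
      (∀ v ∈ W, ((Fcs W).filter fun u => Rect W u ∧ v ∈ Fc W u).card = 3) ∧
      ∀ u ∈ Fcs W, ¬ Rect W u → (Fc W u).card = 3 ∧ ∀ v ∈ W, ¬ Obt W v u) := by
  have h2 : 2 ≤ W.card := by
    obtain ⟨e, he, -⟩ := exists_perp (0 : Euc 3) 0
    have : ∃ w ∈ W, ⟪e, w⟫ ≠ 0 := by
      by_contra hcon
      push Not at hcon
      exact he (hS e hcon)
    obtain ⟨w, hw, hew⟩ := this
    have : 1 < W.card := by
      rw [Finset.one_lt_card_iff]
      refine ⟨w, -w, hw, hneg w hw, ?_⟩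
      intro h
      have h2 := congrArg (fun t => ⟪e, t⟫) h
      simp only [inner_neg_right] at h2
      exact hew (by linarith)
    omega
  have h1 := gab_count hW hneg hS
  have h3 := sum_k hW h2
  have hd : ∀ u ∈ Fcs W, Dn W u + 6 ≤ 2 * (Fc W u).card + 2 * (if Rect W u then 1 else 0) :=
    fun u hu => dn_le hW ((mem_Fcs hW).mp hu)
  have h4 := Finset.sum_le_sum hd
  simp only [Finset.sum_add_distrib, Finset.sum_const, smul_eq_mul, ← Finset.mul_sum] at h4 h1
  have hR : ∑ u ∈ Fcs W, (if Rect W u then 1 else 0) = ((Fcs W).filter fun u => Rect W u).card := by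
    rw [Finset.card_filter]
  rw [hR] at h4
  -- rectangles at vertices
  have hsub : ∀ v, ((Fcs W).filter fun u => Rect W u ∧ v ∈ Fc W u) ⊆
      ((Fcs W).filter fun u => Obt W v u) := by
    intro v u hu
    rw [Finset.mem_filter] at hu ⊢
    exact ⟨hu.1, rect_Obt hW ((mem_Fcs hW).mp hu.1) hu.2.1 hu.2.2⟩
  have h5 : ∀ v ∈ W, ((Fcs W).filter fun u => Rect W u ∧ v ∈ Fc W u).card ≤ 3 := fun v hv =>
    (Finset.card_le_card (hsub v)).trans (obt_le_three hW v hv)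
  have h6 : ∑ v ∈ W, ((Fcs W).filter fun u => Rect W u ∧ v ∈ Fc W u).card =
      4 * ((Fcs W).filter fun u => Rect W u).card := by
    have sM : ∑ v ∈ W, ((Fcs W).filter fun u => Rect W u ∧ v ∈ Fc W u).card =
        ∑ u ∈ Fcs W, (W.filter fun v => Rect W u ∧ v ∈ Fc W u).card :=
      Finset.sum_card_bipartiteAbove_eq_sum_card_bipartiteBelow
        (fun v u => Rect W u ∧ v ∈ Fc W u)
    rw [sM, Finset.card_filter, Finset.mul_sum]
    apply Finset.sum_congr rfl
    intro u hu
    split_ifs with h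
    · rw [← h.1]
      simp only [mul_one]
      congr 1
      ext v
      simp only [Finset.mem_filter, h, true_and, mem_Fc]
      tauto
    · simp [h]
  have h7 := Finset.sum_le_sum h5
  rw [Finset.sum_const, smul_eq_mul, h6] at h7
  refine ⟨by omega, fun heq => ?_⟩
  have t1 : ∀ v ∈ W, ((Fcs W).filter fun u => Rect W u ∧ v ∈ Fc W u).card = 3 := by
    apply (Finset.sum_eq_sum_iff_of_le h5).mp
    rw [Finset.sum_const, smul_eq_mul, h6]
    omega
  refine ⟨t1, ?_⟩
  have t2 : ∀ u ∈ Fcs W, ¬ Rect W u → ∀ v ∈ W, ¬ Obt W v u := by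
    intro u hu hnr v hv ho
    have e1 : ((Fcs W).filter fun u => Rect W u ∧ v ∈ Fc W u) =
        ((Fcs W).filter fun u => Obt W v u) :=
      Finset.eq_of_subset_of_card_le (hsub v) (by rw [t1 v hv]; exact obt_le_three hW v hv)
    have e2 : u ∈ ((Fcs W).filter fun u => Obt W v u) := Finset.mem_filter.mpr ⟨hu, ho⟩
    rw [← e1, Finset.mem_filter] at e2
    exact hnr e2.2.1
  have t3 : ∀ u ∈ Fcs W, Dn W u + 6 = 2 * (Fc W u).card + 2 * (if Rect W u then 1 else 0) := by
    apply (Finset.sum_eq_sum_iff_of_le hd).mp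
    simp only [Finset.sum_add_distrib, Finset.sum_const, smul_eq_mul, ← Finset.mul_sum]
    rw [hR]
    omega
  intro u hu hnr
  refine ⟨?_, t2 u hu hnr⟩
  have hu' := (mem_Fcs hW).mp hu
  have h8 := t3 u hu
  rw [if_neg hnr] at h8
  have h9 : Dn W u = 0 := by
    rw [Dn]
    split_ifs with h4
    · rw [Finset.card_eq_zero, Finset.filter_eq_empty_iff]
      intro v hv hpv
      -- another point sees the diameter at a right angle
      have : ∃ x ∈ Fc W u, x ∉ ({v, par u v} : Finset (Euc 3)) := by
        by_contra hcon
        push Not at hcon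
        have h1 := Finset.card_le_card (fun x hx => hcon x hx : Fc W u ⊆ {v, par u v})
        have h2 := Finset.card_le_two (a := v) (b := par u v)
        omega
      obtain ⟨x, hx, hx2⟩ := this
      simp only [Finset.mem_insert, Finset.mem_singleton, not_or] at hx2
      refine t2 u hu hnr x (mem_Fc.mp hx).1
        ⟨hx, v, par u v, hv, hpv, Ne.symm hx2.1, Ne.symm hx2.2, ?_⟩
      rw [mem_Fc] at hx hv
      simp only [par, inner_sub_left, inner_sub_right, inner_smul_right, hW _ hx.1, hW _ hv.1,
        real_inner_comm u x, real_inner_comm u v, hx.2, hv.2, real_inner_comm x v]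
      linarith
    · rfl
  omega

theorem inner_le_one' {x y : Euc 3} (hx : ⟪x, x⟫ = 1) (hy : ⟪y, y⟫ = 1) : ⟪x, y⟫ ≤ 1 := by
  by_cases h : x = y
  · rw [h, hy]
  · exact (inner_lt_one' hx hy h).le

theorem gab_flat {T : Finset (Euc 3)} (hT : ∀ w ∈ T, ⟪w, w⟫ = 1) (hneg : ∀ w ∈ T, -w ∈ T)
    (hS : ¬ ∀ x : Euc 3, (∀ w ∈ T, ⟪x, w⟫ = 0) → x = 0) :
    2 * (Gab T).card ≤ 7 * T.card + 6 := by
  rcases (Gab T).eq_empty_or_nonempty with h | ⟨⟨a, b⟩, hab⟩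
  · rw [h]; simp
  push Not at hS
  obtain ⟨x, hx, hx0⟩ := hS
  set e : Euc 3 := ‖x‖⁻¹ • x with he
  have ee : ⟪e, e⟫ = 1 := by
    rw [he, real_inner_self_eq_norm_sq, norm_smul, norm_inv, norm_norm,
      inv_mul_cancel₀ (norm_ne_zero_iff.mpr hx0)]; norm_num
  have eT : ∀ w ∈ T, ⟪e, w⟫ = 0 := by
    intro w hw; rw [he, inner_smul_left, hx w hw, mul_zero]
  have Te : ∀ w ∈ T, ⟪w, e⟫ = 0 := fun w hw => by rw [real_inner_comm]; exact eT w hw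
  clear_value e
  have enT : e ∉ T := fun h => by have := eT e h; linarith
  have nenT : -e ∉ T := fun h => enT (by simpa using hneg _ h)
  have ene : e ≠ -e := by
    intro h
    have := congrArg (fun t => ⟪e, t⟫) h
    simp only [inner_neg_right] at this
    linarith
  obtain ⟨⟨ha, hb⟩, hne, hne', -⟩ := mem_Gab.mp hab
  set U : Finset (Euc 3) := insert e (insert (-e) T) with hU
  have hUc : U.card = T.card + 2 := by
    rw [hU, Finset.card_insert_of_notMem, Finset.card_insert_of_notMem nenT]
    simp [ene, enT]
  have memU : ∀ w, w ∈ U ↔ w = e ∨ w = -e ∨ w ∈ T := by intro w; simp [hU]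
  have hU1 : ∀ w ∈ U, ⟪w, w⟫ = 1 := by
    intro w hw
    rcases (memU w).mp hw with rfl | rfl | h
    · exact ee
    · rw [inner_neg_neg]; exact ee
    · exact hT w h
  have hUn : ∀ w ∈ U, -w ∈ U := by
    intro w hw
    rw [memU]
    rcases (memU w).mp hw with rfl | rfl | h
    · simp
    · simp
    · exact Or.inr (Or.inr (hneg w h))
  have hli : LinearIndependent ℝ ![a, b, e] := by
    rw [Fintype.linearIndependent_iff]
    intro g hg
    simp only [Fin.sum_univ_three, Matrix.cons_val_zero, Matrix.cons_val_one,
      Matrix.cons_val] at hg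
    have k1 := congrArg (fun t => ⟪e, t⟫) hg
    have k2 := congrArg (fun t => ⟪a, t⟫) hg
    have k3 := congrArg (fun t => ⟪b, t⟫) hg
    simp only [inner_add_right, inner_smul_right, eT a ha, eT b hb, ee, Te a ha, Te b hb,
      hT a ha, hT b hb, inner_zero_right, real_inner_comm a b] at k1 k2 k3
    have l1 := inner_lt_one' (hT a ha) (hT b hb) hne
    have l2 := inner_lt_one' (hT a ha) (hT _ (hneg b hb)) hne'
    rw [inner_neg_right] at l2
    have p : 0 < (1 - ⟪a, b⟫) * (1 + ⟪a, b⟫) := mul_pos (by linarith) (by linarith)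
    have z0 : g 0 * ((1 - ⟪a, b⟫) * (1 + ⟪a, b⟫)) = 0 := by
      linear_combination k2 - ⟪a, b⟫ * k3
    have z1 : g 1 * ((1 - ⟪a, b⟫) * (1 + ⟪a, b⟫)) = 0 := by
      linear_combination k3 - ⟪a, b⟫ * k2
    intro i
    fin_cases i
    · exact (mul_eq_zero.mp z0).resolve_right p.ne'
    · exact (mul_eq_zero.mp z1).resolve_right p.ne'
    · simp only [Fin.reduceFinMk]; linarith
  have hUS : ∀ y : Euc 3, (∀ w ∈ U, ⟪y, w⟫ = 0) → y = 0 := fun y hy =>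
    perp3 hli (hy a ((memU a).mpr (by simp [ha]))) (hy b ((memU b).mpr (by simp [hb])))
      (hy e ((memU e).mpr (by simp)))
  have hcore := (core hU1 hUn hUS).1
  have hsub : Gab T ∪ (T ×ˢ {e, -e} ∪ {e, -e} ×ˢ T) ⊆ Gab U := by
    rintro ⟨c, d⟩ hcd
    simp only [Finset.mem_union, Finset.mem_product, Finset.mem_insert, Finset.mem_singleton] at hcd
    have gen : ∀ c s : Euc 3, c ∈ T → (s = e ∨ s = -e) → (c, s) ∈ Gab U ∧ (s, c) ∈ Gab U := by
      intro c s hc hs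
      have hsU : s ∈ U := (memU s).mpr (by tauto)
      have hcU : c ∈ U := (memU c).mpr (by tauto)
      have hsT : s ∉ T := by rcases hs with rfl | rfl <;> assumption
      have hnsT : -s ∉ T := by
        rcases hs with rfl | rfl
        · exact nenT
        · simpa using enT
      have c1 : ⟪c, s⟫ = 0 := by
        rcases hs with rfl | rfl
        · exact Te c hc
        · rw [inner_neg_right, Te c hc, neg_zero]
      have c2 : ⟪s, c⟫ = 0 := by rw [real_inner_comm]; exact c1
      have main : ∀ w ∈ U, ⟪c + s, w⟫ ≤ 1 := by
        intro w hw
        rw [inner_add_left]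
        have hc1 := inner_le_one' (hU1 c hcU) (hU1 w hw)
        have hs1 := inner_le_one' (hU1 s hsU) (hU1 w hw)
        rcases (memU w).mp hw with rfl | rfl | h
        · rw [Te c hc]; linarith
        · rw [inner_neg_right, Te c hc]; linarith
        · have : ⟪s, w⟫ = 0 := by
            rcases hs with rfl | rfl
            · exact eT w h
            · rw [inner_neg_left, eT w h, neg_zero]
          linarith
      constructor
      · refine mem_Gab.mpr ⟨⟨hcU, hsU⟩, ?_, ?_, ?_⟩
        · rintro rfl; exact hsT hc
        · rintro rfl; exact hnsT hc
        · intro w hw; rw [c1]; linarith [main w hw]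
      · refine mem_Gab.mpr ⟨⟨hsU, hcU⟩, ?_, ?_, ?_⟩
        · rintro rfl; exact hsT hc
        · rintro rfl; exact hsT (hneg c hc)
        · intro w hw; rw [c2, add_comm s c]; linarith [main w hw]
    rcases hcd with h | ⟨h1, h2⟩ | ⟨h1, h2⟩
    · obtain ⟨⟨hc, hd⟩, n1, n2, h3⟩ := mem_Gab.mp h
      refine mem_Gab.mpr ⟨⟨(memU c).mpr (by simp [hc]), (memU d).mpr (by simp [hd])⟩, n1, n2, ?_⟩
      have p := inner_lt_one' (hT c hc) (hT _ (hneg d hd)) n2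
      rw [inner_neg_right] at p
      intro w hw
      rcases (memU w).mp hw with rfl | rfl | h
      · rw [inner_add_left, Te c hc, Te d hd]; linarith
      · rw [inner_neg_right, inner_add_left, Te c hc, Te d hd]; linarith
      · exact h3 w h
    · exact (gen c d h1 h2).1
    · exact (gen d c h2 h1).2
  have hcard := Finset.card_le_card hsub
  have hTe : ∀ s, (s = e ∨ s = -e) → s ∉ T := by rintro s (rfl | rfl) <;> assumption
  rw [Finset.card_union_of_disjoint, Finset.card_union_of_disjoint, Finset.card_product,
    Finset.card_product, Finset.card_pair ene] at hcard
  · omega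
  · rw [Finset.disjoint_left]
    rintro ⟨c, d⟩ h1 h2
    simp only [Finset.mem_product, Finset.mem_insert, Finset.mem_singleton] at h1 h2
    exact hTe c h2.1 h1.1
  · rw [Finset.disjoint_left]
    rintro ⟨c, d⟩ h1 h2
    have h1 := (mem_Gab.mp h1).1
    simp only [Finset.mem_union, Finset.mem_product, Finset.mem_insert,
      Finset.mem_singleton] at h2
    rcases h2 with h2 | h2
    · exact hTe d h2.2 h1.2
    · exact hTe c h2.1 h1.1

theorem dn_count {V : Finset (Euc 3)} (hV : ∀ v ∈ V, ⟪v, v⟫ = 1) :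
    2 * ((V ×ˢ V).filter fun pq => IsDNPair V pq.1 pq.2).card ≤
      2 * (V.filter fun v => -v ∈ V).card + (Gab (V ∪ V.image Neg.neg)).card +
        (Gab (V.filter fun v => -v ∈ V)).card := by
  set T := V.filter fun v => -v ∈ V with hT
  set W := V ∪ V.image Neg.neg with hW
  have memW : ∀ w, w ∈ W ↔ w ∈ V ∨ -w ∈ V := by
    intro w; simp only [hW, Finset.mem_union, Finset.mem_image]
    constructor
    · rintro (h | ⟨a, h, rfl⟩)
      · exact Or.inl h
      · right; simpa using h
    · rintro (h | h)
      · exact Or.inl h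
      · exact Or.inr ⟨_, h, by simp⟩
  set S := (V ×ˢ V).filter fun pq => IsDNPair V pq.1 pq.2 with hS
  set A := (Gab W).filter fun p => p.1 ∈ V ∧ -p.2 ∈ V with hA
  set A' := (Gab W).filter fun p => -p.1 ∈ V ∧ p.2 ∈ V with hA'
  have h0 : (S.filter fun p => p.2 = -p.1).card + (S.filter fun p => ¬ p.2 = -p.1).card = S.card :=
    Finset.card_filter_add_card_filter_not _
  have h1 : (S.filter fun p => p.2 = -p.1).card ≤ T.card := by
    apply Finset.card_le_card_of_injOn Prod.fst
    · rintro ⟨p, q⟩ h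
      have h := Finset.mem_filter.mp (Finset.mem_coe.mp h)
      have h2 := (Finset.mem_filter.mp h.1).2
      have h3 : q = -p := h.2
      apply Finset.mem_coe.mpr
      exact Finset.mem_filter.mpr ⟨h2.1, by rw [← h3]; exact h2.2.1⟩
    · rintro ⟨p, q⟩ h ⟨p', q'⟩ h' he
      have h := (Finset.mem_filter.mp (Finset.mem_coe.mp h)).2
      have h' := (Finset.mem_filter.mp (Finset.mem_coe.mp h')).2
      simp only at h h' he
      rw [h, h', he]
  have h2 : (S.filter fun p => ¬ p.2 = -p.1).card ≤ A.card := by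
    apply Finset.card_le_card_of_injOn (fun p => (p.1, -p.2))
    · rintro ⟨p, q⟩ h
      have h := Finset.mem_filter.mp (Finset.mem_coe.mp h)
      obtain ⟨hp, hq, hpq, hd⟩ := (Finset.mem_filter.mp h.1).2
      have h3 : ¬ q = -p := h.2
      simp only at hp hq hpq hd
      apply Finset.mem_coe.mpr
      refine Finset.mem_filter.mpr ⟨mem_Gab.mpr ⟨⟨?_, ?_⟩, ?_, ?_, ?_⟩, hp, by simpa using hq⟩
      · exact (memW p).mpr (Or.inl hp)
      · exact (memW _).mpr (Or.inr (by simpa using hq))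
      · intro h
        have h : p = -q := h
        apply h3; rw [h]; simp
      · simpa using hpq
      · intro w hw
        have hp1 := hV p hp
        have hq1 := hV q hq
        rcases (memW w).mp hw with h | h
        · have := (hd w h).1
          simp only [inner_sub_left, inner_sub_right, inner_add_left, inner_neg_left,
            inner_neg_right, hp1, real_inner_comm w p, real_inner_comm w q] at this ⊢
          linarith
        · have := (hd _ h).2
          simp only [inner_sub_left, inner_sub_right, inner_add_left, inner_neg_left,
            inner_neg_right, hq1, real_inner_comm w p, real_inner_comm w q,
            real_inner_comm p q] at this ⊢
          linarith
    · rintro ⟨p, q⟩ _ ⟨p', q'⟩ _ he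
      simpa using he
  have h3 : A.card ≤ A'.card := by
    apply Finset.card_le_card_of_injOn (fun p => (-p.1, -p.2))
    · rintro ⟨p, q⟩ h
      have h := Finset.mem_filter.mp (Finset.mem_coe.mp h)
      obtain ⟨⟨k1, k2⟩, k3, k4, k5⟩ := mem_Gab.mp h.1
      apply Finset.mem_coe.mpr
      refine Finset.mem_filter.mpr ⟨mem_Gab.mpr ⟨⟨?_, ?_⟩, ?_, ?_, ?_⟩, ?_, h.2.2⟩
      · rw [memW] at k1 ⊢; simpa [or_comm] using k1
      · rw [memW] at k2 ⊢; simpa [or_comm] using k2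
      · simpa using k3
      · intro h; exact k4 (neg_injective h)
      · intro w hw
        have := k5 (-w) (by rw [memW] at hw ⊢; simpa [or_comm] using hw)
        simp only [inner_add_left, inner_neg_left, inner_neg_right] at this ⊢
        linarith
      · simpa using h.2.1
    · rintro ⟨p, q⟩ _ ⟨p', q'⟩ _ he
      simpa using he
  have h4 := Finset.card_union_add_card_inter A A'
  have h5 : (A ∪ A').card ≤ (Gab W).card := Finset.card_le_card
    (Finset.union_subset (Finset.filter_subset _ _) (Finset.filter_subset _ _))
  have h6 : (A ∩ A').card ≤ (Gab T).card := by
    apply Finset.card_le_card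
    rintro ⟨p, q⟩ h
    rw [Finset.mem_inter, Finset.mem_filter, Finset.mem_filter] at h
    obtain ⟨⟨k, a1, a2⟩, ⟨_, a3, a4⟩⟩ := h
    obtain ⟨⟨k1, k2⟩, k3, k4, k5⟩ := mem_Gab.mp k
    refine mem_Gab.mpr ⟨⟨Finset.mem_filter.mpr ⟨a1, a3⟩, Finset.mem_filter.mpr ⟨a4, a2⟩⟩, k3, k4, ?_⟩
    intro w hw
    exact k5 w ((memW w).mpr (Or.inl (Finset.mem_filter.mp hw).1))
  omega

theorem symm_struct {V : Finset (Euc 3)} (hV : ∀ v ∈ V, ⟪v, v⟫ = 1) (hcard : 8 ≤ V.card)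
    (hN : (numDN V : ℝ) = 17 / 4 * V.card - 6) :
    (∀ v ∈ V, -v ∈ V) ∧ (∀ x : Euc 3, (∀ w ∈ V, ⟪x, w⟫ = 0) → x = 0) ∧
      15 * V.card ≤ 2 * (Gab V).card + 24 := by
  have h1 := dn_count hV
  set S := (V ×ˢ V).filter fun pq => IsDNPair V pq.1 pq.2 with hS
  have h2 : numDN V * 2 ≤ S.card := Nat.div_mul_le_self _ _
  have h3 : 4 * numDN V + 24 = 17 * V.card := by
    have : (4 * numDN V + 24 : ℝ) = 17 * V.card := by linarith
    exact_mod_cast this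
  set T := V.filter fun v => -v ∈ V with hT
  set W := V ∪ V.image Neg.neg with hW
  have hTV : T ⊆ V := Finset.filter_subset _ _
  have memW : ∀ w, w ∈ W ↔ w ∈ V ∨ -w ∈ V := by
    intro w; simp only [hW, Finset.mem_union, Finset.mem_image]
    constructor
    · rintro (h | ⟨a, h, rfl⟩)
      · exact Or.inl h
      · right; simpa using h
    · rintro (h | h)
      · exact Or.inl h
      · exact Or.inr ⟨_, h, by simp⟩
  have hWc : W.card + T.card = 2 * V.card := by
    have := Finset.card_union_add_card_inter V (V.image Neg.neg)
    rw [Finset.card_image_of_injective _ neg_injective] at this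
    have e : V ∩ V.image Neg.neg = T := by
      ext x
      simp only [Finset.mem_inter, Finset.mem_image, hT, Finset.mem_filter]
      constructor
      · rintro ⟨h, a, ha, rfl⟩; exact ⟨h, by simpa using ha⟩
      · rintro ⟨h, h'⟩; exact ⟨h, _, h', by simp⟩
    rw [e] at this
    change W.card + _ = _ at this
    omega
  have hTc := Finset.card_le_card hTV
  have hT1 : ∀ w ∈ T, ⟪w, w⟫ = 1 := fun w hw => hV w (hTV hw)
  have hW1 : ∀ w ∈ W, ⟪w, w⟫ = 1 := by
    intro w hw
    rcases (memW w).mp hw with h | h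
    · exact hV w h
    · rw [← inner_neg_neg]; exact hV _ h
  have hTn : ∀ w ∈ T, -w ∈ T := by
    intro w hw
    rw [hT, Finset.mem_filter] at hw ⊢
    exact ⟨hw.2, by simpa using hw.1⟩
  have hWn : ∀ w ∈ W, -w ∈ W := by
    intro w hw
    rw [memW] at hw ⊢
    simpa [or_comm] using hw
  by_cases sT : ∀ x : Euc 3, (∀ w ∈ T, ⟪x, w⟫ = 0) → x = 0
  · have sW : ∀ x : Euc 3, (∀ w ∈ W, ⟪x, w⟫ = 0) → x = 0 := fun x hx =>
      sT x fun w hw => hx w ((memW w).mpr (Or.inl (hTV hw)))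
    have c1 := (core hT1 hTn sT).1
    have c2 := (core hW1 hWn sW).1
    have e1 : T = V := Finset.eq_of_subset_of_card_le hTV (by omega)
    have hn : ∀ v ∈ V, -v ∈ V := by
      intro v hv; rw [← e1] at hv ⊢; exact hTn v hv
    have e2 : W = V := by
      ext w; rw [memW]
      constructor
      · rintro (h | h)
        · exact h
        · simpa using hn _ h
      · exact Or.inl
    rw [e1] at sT h1
    rw [e2] at h1
    refine ⟨hn, sT, ?_⟩
    omega
  · exfalso
    have c1 := gab_flat hT1 hTn sT
    by_cases sW : ∀ x : Euc 3, (∀ w ∈ W, ⟪x, w⟫ = 0) → x = 0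
    · have c2 := (core hW1 hWn sW).1
      omega
    · have c2 := gab_flat hW1 hWn sW
      omega

theorem hull_le {S : Finset (Euc 3)} {u : Euc 3} {c : ℝ} (h : ∀ w ∈ S, ⟪u, w⟫ ≤ c) {p : Euc 3}
    (hp : p ∈ convexHull ℝ (S : Set (Euc 3))) : ⟪u, p⟫ ≤ c := by
  have : convexHull ℝ (S : Set (Euc 3)) ⊆ {p | ⟪u, p⟫ ≤ c} := by
    apply convexHull_min
    · intro w hw; exact h w hw
    · exact convex_halfSpace_le (innerₛₗ ℝ u).isLinear c
  exact this hp

theorem hull_eq {S : Finset (Euc 3)} {u : Euc 3} {c : ℝ} (h : ∀ w ∈ S, ⟪u, w⟫ = c) {p : Euc 3}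
    (hp : p ∈ convexHull ℝ (S : Set (Euc 3))) : ⟪u, p⟫ = c := by
  apply le_antisymm (hull_le (fun w hw => (h w hw).le) hp)
  have := hull_le (u := -u) (c := -c) (fun w hw => by rw [inner_neg_left, h w hw]) hp
  rw [inner_neg_left] at this
  linarith

theorem face_hull {W : Finset (Euc 3)} {u : Euc 3} (h : ∀ w ∈ W, ⟪u, w⟫ ≤ 1) (p : Euc 3) :
    p ∈ convexHull ℝ (Fc W u : Set (Euc 3)) ↔
      p ∈ convexHull ℝ (W : Set (Euc 3)) ∧ ⟪u, p⟫ = 1 := by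
  constructor
  · intro hp
    refine ⟨convexHull_mono ?_ hp, hull_eq (fun w hw => (mem_Fc.mp hw).2) hp⟩
    intro w hw
    exact (mem_Fc.mp hw).1
  · rintro ⟨hp, hu⟩
    rw [Finset.mem_convexHull'] at hp ⊢
    obtain ⟨f, f0, f1, rfl⟩ := hp
    rw [inner_sum] at hu
    have hz : ∑ y ∈ W, f y * (1 - ⟪u, y⟫) = 0 := by
      have : ∀ y, f y * (1 - ⟪u, y⟫) = f y - ⟪u, f y • y⟫ := by
        intro y; rw [inner_smul_right]; ring
      simp only [this, Finset.sum_sub_distrib, f1, hu]; norm_num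
    rw [Finset.sum_eq_zero_iff_of_nonneg
      (fun y hy => mul_nonneg (f0 y hy) (by linarith [h y hy]))] at hz
    have hz' : ∀ y ∈ W, y ∉ Fc W u → f y = 0 := by
      intro y hy hn
      rcases mul_eq_zero.mp (hz y hy) with h | h
      · exact h
      · exact absurd (mem_Fc.mpr ⟨hy, by linarith⟩) hn
    have hs : Fc W u ⊆ W := Finset.filter_subset _ _
    refine ⟨f, fun y hy => f0 y (hs hy), ?_, ?_⟩
    · rw [← f1]; exact Finset.sum_subset hs hz'
    · exact Finset.sum_subset hs fun y hy hn => by rw [hz' y hy hn, zero_smul]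

theorem vs_hull (S : Set (Euc 3)) : vectorSpan ℝ (convexHull ℝ S) = vectorSpan ℝ S := by
  rw [← direction_affineSpan, affineSpan_convexHull, direction_affineSpan]

theorem aff3 {u x y z : Euc 3} (hx : ⟪x, x⟫ = 1) (hy : ⟪y, y⟫ = 1) (hz : ⟪z, z⟫ = 1)
    (ux : ⟪u, x⟫ = 1) (uy : ⟪u, y⟫ = 1) (uz : ⟪u, z⟫ = 1)
    (hxy : x ≠ y) (hxz : x ≠ z) (hyz : y ≠ z) : AffineIndependent ℝ ![x, y, z] :=
  (li3 hx hy hz ux uy uz hxy hxz hyz).affineIndependent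

theorem face_of {V : Finset (Euc 3)}
    (hneg : ∀ v ∈ V, -v ∈ V) (hS : ∀ x : Euc 3, (∀ w ∈ V, ⟪x, w⟫ = 0) → x = 0) {F : Set (Euc 3)}
    (hF : IsTwoDimExpFace (convexHull ℝ (V : Set (Euc 3))) F) :
    ∃ u, IsFc V u ∧ F = convexHull ℝ (Fc V u : Set (Euc 3)) := by
  obtain ⟨⟨u, hu0, hFu⟩, hr⟩ := hF
  have hne : F.Nonempty := by
    rw [Set.nonempty_iff_ne_empty]
    rintro rfl
    rw [vectorSpan_empty] at hr
    simp at hr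
  obtain ⟨p, hp⟩ := hne
  have hp' := hp
  rw [hFu] at hp'
  obtain ⟨hpP, hpm⟩ := hp'
  have hle : ∀ w ∈ V, ⟪u, w⟫ ≤ ⟪u, p⟫ := by
    intro w hw
    have := hpm w (subset_convexHull ℝ _ hw)
    rwa [real_inner_comm u w, real_inner_comm u p] at this
  have hM : 0 < ⟪u, p⟫ := by
    by_contra hc
    apply hu0
    apply hS
    intro w hw
    have h1 := hle w hw
    have h2 := hle _ (hneg w hw)
    rw [inner_neg_right] at h2
    linarith
  set M := ⟪u, p⟫ with hMd
  have key : ∀ x, ⟪M⁻¹ • u, x⟫ = M⁻¹ * ⟪u, x⟫ := by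
    intro x; rw [inner_smul_left, RCLike.conj_to_real]
  have hle1 : ∀ w ∈ V, ⟪M⁻¹ • u, w⟫ ≤ 1 := by
    intro w hw
    rw [key, inv_mul_le_iff₀ hM, mul_one]; exact hle w hw
  have hFe : F = convexHull ℝ (Fc V (M⁻¹ • u) : Set (Euc 3)) := by
    ext q
    rw [face_hull hle1, key, hFu]
    constructor
    · rintro ⟨h1, h2⟩
      refine ⟨h1, ?_⟩
      have a := h2 p hpP
      have b := hpm q h1
      have : ⟪u, q⟫ = M := by
        rw [hMd, real_inner_comm q u, real_inner_comm p u]; exact le_antisymm b a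
      rw [this, inv_mul_cancel₀ hM.ne']
    · rintro ⟨h1, h2⟩
      refine ⟨h1, fun x hx => ?_⟩
      have : ⟪u, q⟫ = M := by field_simp at h2; exact h2
      have b := hpm x hx
      rw [real_inner_comm u q, this, hMd, real_inner_comm p u]
      exact b
  refine ⟨M⁻¹ • u, ⟨hle1, ?_⟩, hFe⟩
  by_contra hc
  rw [hFe, vs_hull] at hr
  have hne : (Fc V (M⁻¹ • u)).card ≠ 0 := by
    intro h
    rw [Finset.card_eq_zero.mp h, Finset.coe_empty, vectorSpan_empty] at hr
    simp at hr
  obtain ⟨n, hn⟩ := Nat.exists_eq_succ_of_ne_zero hne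
  have := finrank_vectorSpan_image_finset_le ℝ id (Fc V (M⁻¹ • u)) hn
  rw [Finset.image_id] at this
  omega

theorem face_is {V : Finset (Euc 3)} (hV : ∀ v ∈ V, ⟪v, v⟫ = 1) {u : Euc 3} (hu : IsFc V u) :
    IsTwoDimExpFace (convexHull ℝ (V : Set (Euc 3))) (convexHull ℝ (Fc V u : Set (Euc 3))) := by
  obtain ⟨x, y, z, hx, hy, hz, hxy, hxz, hyz⟩ := Finset.two_lt_card_iff.mp hu.2
  have h1 := mem_Fc.mp hx
  have h2 := mem_Fc.mp hy
  have h3 := mem_Fc.mp hz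
  have u0 : u ≠ 0 := by
    rintro rfl
    have := h1.2
    rw [inner_zero_left] at this
    norm_num at this
  refine ⟨⟨u, u0, ?_⟩, ?_⟩
  · ext p
    rw [face_hull hu.1]
    constructor
    · rintro ⟨k1, k2⟩
      refine ⟨k1, fun q hq => ?_⟩
      rw [real_inner_comm u q, real_inner_comm u p, k2]
      exact hull_le hu.1 hq
    · rintro ⟨k1, k2⟩
      refine ⟨k1, le_antisymm (hull_le hu.1 k1) ?_⟩
      have := k2 x (subset_convexHull ℝ _ h1.1)
      rwa [real_inner_comm u x, real_inner_comm u p, h1.2] at this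
  · rw [vs_hull]
    apply le_antisymm
    · have hle : vectorSpan ℝ (Fc V u : Set (Euc 3)) ≤ (ℝ ∙ u)ᗮ := by
        rw [vectorSpan_def, Submodule.span_le]
        rintro _ ⟨a, ha, b, hb, rfl⟩
        have ha := (mem_Fc.mp (Finset.mem_coe.mp ha)).2
        have hb := (mem_Fc.mp (Finset.mem_coe.mp hb)).2
        apply Submodule.mem_orthogonal_singleton_iff_inner_right.mpr
        change ⟪u, a - b⟫ = 0
        rw [inner_sub_right, ha, hb, sub_self]
      have hm := Submodule.finrank_mono hle
      have : Fact (Module.finrank ℝ (Euc 3) = 2 + 1) := ⟨by simp⟩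
      rwa [Submodule.finrank_orthogonal_span_singleton (n := 2) u0] at hm
    · have ha := aff3 (hV x h1.1) (hV y h2.1) (hV z h3.1) h1.2 h2.2 h3.2 hxy hxz hyz
      have hf := ha.finrank_vectorSpan (n := 2) (by simp)
      rw [← hf]
      apply Submodule.finrank_mono
      apply vectorSpan_mono
      rintro _ ⟨i, rfl⟩
      fin_cases i
      · exact hx
      · exact hy
      · exact hz

theorem face_inj {V : Finset (Euc 3)} (hV : ∀ v ∈ V, ⟪v, v⟫ = 1) {u u' : Euc 3} (hu : IsFc V u)
    (h : convexHull ℝ (Fc V u : Set (Euc 3)) = convexHull ℝ (Fc V u' : Set (Euc 3))) :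
    u = u' := by
  apply fc_inj hV hu
  intro w hw
  have : w ∈ convexHull ℝ (Fc V u' : Set (Euc 3)) := by
    rw [← h]; exact subset_convexHull ℝ _ hw
  exact hull_eq (fun w hw => (mem_Fc.mp hw).2) this

theorem rect_is {V : Finset (Euc 3)} (hV : ∀ v ∈ V, ⟪v, v⟫ = 1) {u : Euc 3} (hu : IsFc V u)
    (hr : Rect V u) : IsRectangle (convexHull ℝ (Fc V u : Set (Euc 3))) := by
  obtain ⟨v, hv⟩ : (Fc V u).Nonempty := Finset.card_pos.mp (by have := hu.2; omega)
  obtain ⟨x, hx, n1, n2, h0⟩ := rect_obt hV hu hr hv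
  have pv := par_ne hV hu hv
  have px := par_ne hV hu hx
  have n3 : v ≠ par u x := by
    intro h; apply n2; rw [h, par_par]
  have n4 : par u v ≠ par u x := by
    intro h; apply n1; rw [← par_par u v, h, par_par]
  refine ⟨v, x, par u v, par u x, n1.symm, pv.symm, n3, n2, px.symm, n4, ?_, h0, ?_⟩
  · simp [par]
  · have : ({v, x, par u v, par u x} : Finset (Euc 3)) = Fc V u := by
      apply Finset.eq_of_subset_of_card_le
      · intro w hw
        simp only [Finset.mem_insert, Finset.mem_singleton] at hw
        rcases hw with rfl | rfl | rfl | rfl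
        · exact hv
        · exact hx
        · exact hr.2 _ hv
        · exact hr.2 _ hx
      · rw [hr.1, Finset.card_insert_of_notMem (by simp [n1.symm, pv.symm, n3]),
          Finset.card_insert_of_notMem (by simp [n2, px.symm]), Finset.card_pair n4]
    rw [← this]
    simp

theorem acute_is {V : Finset (Euc 3)} (hV : ∀ v ∈ V, ⟪v, v⟫ = 1) {u : Euc 3}
    (hc : (Fc V u).card = 3) (ho : ∀ v ∈ V, ¬ Obt V v u) :
    IsAcuteTriangle (convexHull ℝ (Fc V u : Set (Euc 3))) := by
  obtain ⟨a, b, c, hab, hac, hbc, he⟩ := Finset.card_eq_three.mp hc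
  have ha : a ∈ Fc V u := by rw [he]; simp
  have hb : b ∈ Fc V u := by rw [he]; simp
  have hc' : c ∈ Fc V u := by rw [he]; simp
  have h1 := mem_Fc.mp ha
  have h2 := mem_Fc.mp hb
  have h3 := mem_Fc.mp hc'
  refine ⟨a, b, c, aff3 (hV a h1.1) (hV b h2.1) (hV c h3.1) h1.2 h2.2 h3.2 hab hac hbc,
    ?_, ?_, ?_, ?_⟩
  · by_contra h
    exact ho a h1.1 ⟨ha, b, c, hb, hc', hab.symm, hac.symm, not_lt.mp h⟩
  · by_contra h
    exact ho b h2.1 ⟨hb, a, c, ha, hc', hab, hbc.symm, not_lt.mp h⟩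
  · by_contra h
    exact ho c h3.1 ⟨hc', a, b, ha, hb, hac, hbc, not_lt.mp h⟩
  · rw [he]; simp

theorem not_rect {V : Finset (Euc 3)} (hV : ∀ v ∈ V, ⟪v, v⟫ = 1) {u : Euc 3}
    (hc : (Fc V u).card = 3) (ho : ∀ v ∈ V, ¬ Obt V v u) :
    ¬ IsRectangle (convexHull ℝ (Fc V u : Set (Euc 3))) := by
  rintro ⟨w, x, y, z, wx, wy, wz, xy, xz, yz, hs, h0, he⟩
  have he' : convexHull ℝ (Fc V u : Set (Euc 3)) =
      convexHull ℝ (({w, x, y, z} : Finset (Euc 3)) : Set (Euc 3)) := by rw [he]; simp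
  set R : Finset (Euc 3) := {w, x, y, z} with hR
  have hRc : R.card = 4 := by
    rw [hR, Finset.card_insert_of_notMem (by simp [wx, wy, wz]),
      Finset.card_insert_of_notMem (by simp [xy, xz]), Finset.card_pair yz]
  have hball : ∀ s ∈ R, ⟪s, s⟫ ≤ 1 := by
    intro s hs
    have h1 : s ∈ convexHull ℝ (Fc V u : Set (Euc 3)) := by
      rw [he']; exact subset_convexHull ℝ _ hs
    have h2 : convexHull ℝ (Fc V u : Set (Euc 3)) ⊆ Metric.closedBall 0 1 := by
      apply convexHull_min _ (convex_closedBall 0 1)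
      intro t ht
      have := hV t (mem_Fc.mp (Finset.mem_coe.mp ht)).1
      rw [real_inner_self_eq_norm_sq] at this
      rw [mem_closedBall_zero_iff]
      nlinarith [norm_nonneg t]
    have h3 := mem_closedBall_zero_iff.mp (h2 h1)
    rw [real_inner_self_eq_norm_sq]
    nlinarith [norm_nonneg s]
  have hsub : Fc V u ⊆ R := by
    intro v hv
    by_contra hn
    have hv1 := hV v (mem_Fc.mp hv).1
    have hvR : v ∈ convexHull ℝ (R : Set (Euc 3)) := by
      rw [← he']; exact subset_convexHull ℝ _ hv
    have hlt : ∀ s ∈ R, ⟪v, s⟫ < 1 := by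
      intro s hs
      have p : 0 < ⟪v - s, v - s⟫ := by
        rw [real_inner_self_eq_norm_sq]
        have : 0 < ‖v - s‖ := norm_pos_iff.mpr (sub_ne_zero.mpr (by rintro rfl; exact hn hs))
        positivity
      have := hball s hs
      rw [inner_sub_left, inner_sub_right, inner_sub_right, real_inner_comm v s] at p
      linarith
    have : convexHull ℝ (R : Set (Euc 3)) ⊆ {p | ⟪v, p⟫ < 1} := by
      apply convexHull_min
      · intro s hs; exact hlt s hs
      · exact convex_halfSpace_lt (innerₛₗ ℝ v).isLinear 1
    have h : ⟪v, v⟫ < 1 := this hvR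
    linarith
  have hd : (R \ Fc V u).card = 1 := by
    rw [Finset.card_sdiff_of_subset hsub]; omega
  obtain ⟨m, hm⟩ := Finset.card_eq_one.mp hd
  have hin : ∀ s ∈ R, s ≠ m → s ∈ Fc V u := by
    intro s hs hsm
    by_contra hn
    have : s ∈ R \ Fc V u := Finset.mem_sdiff.mpr ⟨hs, hn⟩
    rw [hm, Finset.mem_singleton] at this
    exact hsm this
  have hmR : m ∈ R := (Finset.mem_sdiff.mp (by rw [hm]; simp : m ∈ R \ Fc V u)).1
  have mk : ∀ a b c, a ∈ Fc V u → b ∈ Fc V u → c ∈ Fc V u → b ≠ a → c ≠ a →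
      ⟪b - a, c - a⟫ = 0 → False := fun a b c ha hb hc hba hca h =>
    ho a (mem_Fc.mp ha).1 ⟨ha, b, c, hb, hc, hba, hca, h.le⟩
  have mw : w ∈ R := by simp [hR]
  have mx : x ∈ R := by simp [hR]
  have my : y ∈ R := by simp [hR]
  have mz : z ∈ R := by simp [hR]
  have hy : y = x + z - w := by rw [← hs]; simp
  have h0' : ⟪z - w, x - w⟫ = 0 := by rw [real_inner_comm]; exact h0
  simp only [hR, Finset.mem_insert, Finset.mem_singleton] at hmR
  rcases hmR with h | h | h | h
  · rw [h] at hin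
    refine mk y x z (hin y my wy.symm) (hin x mx wx.symm) (hin z mz wz.symm) xy yz.symm ?_
    rw [show x - y = -(z - w) by rw [hy]; abel, show z - y = -(x - w) by rw [hy]; abel,
      inner_neg_neg, h0']
  · rw [h] at hin
    refine mk z w y (hin z mz xz.symm) (hin w mw wx) (hin y my xy.symm) wz yz ?_
    rw [show w - z = -(z - w) by abel, show y - z = x - w by rw [hy]; abel,
      inner_neg_left, h0', neg_zero]
  · rw [h] at hin
    exact mk w x z (hin w mw wy) (hin x mx xy) (hin z mz yz.symm) wx.symm wz.symm h0
  · rw [h] at hin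
    refine mk x w y (hin x mx xz) (hin w mw wz) (hin y my yz) wx xy.symm ?_
    rw [show w - x = -(x - w) by abel, show y - x = z - w by rw [hy]; abel,
      inner_neg_left, h0, neg_zero]

/-- If `V ⊆ S²` with `|V| ≥ 8` satisfies `N(V) = (17/4)|V| - 6`, then `V` is symmetric about
the origin, every 2-dimensional exposed face of `conv V` is a rectangle or an acute triangle,
and every point of `V` lies on exactly 3 rectangular 2-dimensional exposed faces. -/
theorem doubleNormal_sphere_equality_structure (V : Finset (Euc 3))
    (hV : ∀ v ∈ V, ‖v‖ = 1) (hcard : 8 ≤ V.card)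
    (hN : (numDN V : ℝ) = 17 / 4 * V.card - 6) :
    (∀ v ∈ V, -v ∈ V) ∧
    (∀ F : Set (Euc 3), IsTwoDimExpFace (convexHull ℝ (V : Set (Euc 3))) F →
      IsRectangle F ∨ IsAcuteTriangle F) ∧
    (∀ v ∈ V,
      {F : Set (Euc 3) | IsTwoDimExpFace (convexHull ℝ (V : Set (Euc 3))) F ∧
        IsRectangle F ∧ v ∈ F}.ncard = 3) := by

  have hV1 : ∀ v ∈ V, ⟪v, v⟫ = 1 := by
    intro v hv; rw [real_inner_self_eq_norm_sq, hV v hv]; norm_num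
  obtain ⟨hneg, hS, h15⟩ := symm_struct hV1 hcard hN
  obtain ⟨hthree, htri⟩ := (core hV1 hneg hS).2 h15
  refine ⟨hneg, ?_, ?_⟩
  · intro F hF
    obtain ⟨u, hu, rfl⟩ := face_of hneg hS hF
    by_cases hr : Rect V u
    · exact Or.inl (rect_is hV1 hu hr)
    · obtain ⟨hc, ho⟩ := htri u ((mem_Fcs hV1).mpr hu) hr
      exact Or.inr (acute_is hV1 hc ho)
  · intro v hv
    refine Eq.trans ?_ (hthree v hv)
    rw [← Set.ncard_coe_finset]
    have hE : {F : Set (Euc 3) | IsTwoDimExpFace (convexHull ℝ (V : Set (Euc 3))) F ∧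
        IsRectangle F ∧ v ∈ F} = (fun u => convexHull ℝ (Fc V u : Set (Euc 3))) ''
          (((Fcs V).filter fun u => Rect V u ∧ v ∈ Fc V u : Finset (Euc 3)) : Set (Euc 3)) := by
      ext F
      constructor
      · rintro ⟨h1, h2, h3⟩
        obtain ⟨u, hu, rfl⟩ := face_of hneg hS h1
        refine ⟨u, Finset.mem_coe.mpr (Finset.mem_filter.mpr ⟨(mem_Fcs hV1).mpr hu, ?_, ?_⟩), rfl⟩
        · by_contra hr
          obtain ⟨hc, ho⟩ := htri u ((mem_Fcs hV1).mpr hu) hr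
          exact not_rect hV1 hc ho h2
        · exact mem_Fc.mpr ⟨hv, ((face_hull hu.1 v).mp h3).2⟩
      · rintro ⟨u, hu, rfl⟩
        obtain ⟨h1, h2, h3⟩ := Finset.mem_filter.mp (Finset.mem_coe.mp hu)
        have hu := (mem_Fcs hV1).mp h1
        exact ⟨face_is hV1 hu, rect_is hV1 hu h2, subset_convexHull ℝ _ h3⟩
    rw [hE]
    apply Set.ncard_image_of_injOn
    intro u hu u' hu' h
    exact face_inj hV1 ((mem_Fcs hV1).mp (Finset.mem_filter.mp (Finset.mem_coe.mp hu)).1) h
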